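/- Let P ⊂ ℝ^n be an n-dimensional simple lattice polytope of degree d with d < n. If d < n − d (equivalently, 2·deg(P) ≤ n − 1, equivalently 2·cd(P) ≥ n + 3), then c(P) = 0. -/

import Mathlib

open scoped Pointwise
open MeasureTheory

noncomputable section

/-- The image of an integer point under the coercion `ℤ → ℝ` (a lattice point). -/
def latt {ι : Type*} (x : ι → ℤ) : ι → ℝ := fun i => (x i : ℝ)

/-- A lattice polytope: the convex hull of finitely many points of `ℤ^ι`. -/
def IsLatticePolytope {ι : Type*} (P : Set (ι → ℝ)) : Prop :=
  ∃ V : Finset (ι → ℤ), P = convexHull ℝ (latt '' (V : Set (ι → ℤ)))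

/-- The codegree: the smallest positive integer `k` such that the (relative) interior
of the dilate `kP` contains a lattice point. -/
def cd {ι : Type*} (P : Set (ι → ℝ)) : ℕ :=
  sInf {k : ℕ | 1 ≤ k ∧ ∃ x : ι → ℤ, latt x ∈ intrinsicInterior ℝ ((k : ℝ) • P)}

/-- `F` is a (nonempty, exposed) face of `P` of dimension `j`. -/
def IsFaceOfDim {n : ℕ} (P F : Set (Fin n → ℝ)) (j : ℕ) : Prop :=
  F.Nonempty ∧ IsExposed ℝ P F ∧ Module.finrank ℝ (affineSpan ℝ F).direction = j

/-- A polytope is simple if every vertex (0-dimensional face) is contained in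
exactly `n` facets ((n-1)-dimensional faces). -/
def IsSimplePolytope {n : ℕ} (P : Set (Fin n → ℝ)) : Prop :=
  ∀ F0, IsFaceOfDim P F0 0 → {F | IsFaceOfDim P F (n - 1) ∧ F0 ⊆ F}.ncard = n

/-- `φ : ℝ^j → ℝ^n` is an affine parametrization of the affine hull of `F` mapping the
lattice `ℤ^j` bijectively onto `aff(F) ∩ ℤ^n`.  Pulling `F` back by such a `φ` computes
volumes with respect to the lattice `aff(F) ∩ ℤ^n`. -/
def IsUnimodularParam {n j : ℕ} (F : Set (Fin n → ℝ))
    (φ : (Fin j → ℝ) →ᵃ[ℝ] (Fin n → ℝ)) : Prop :=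
  Function.Injective φ ∧
    Set.range φ = (affineSpan ℝ F : Set (Fin n → ℝ)) ∧
    ∀ x : Fin j → ℝ, (∃ w : Fin j → ℤ, x = latt w) ↔ ∃ z : Fin n → ℤ, φ x = latt z

lemma exists_pos_generic {ι κ : Type*} [Fintype ι] [Finite κ] (a : κ → ι → ℝ)
    (ha : ∀ k, a k ≠ 0) :
    ∃ w : ι → ℝ, (∀ i, 0 < w i) ∧ ∀ k, ∑ i, w i * a k i ≠ 0 := by
  classical
  have := Fintype.ofFinite κ
  let e := Fintype.equivFin ι
  let p : κ → Polynomial ℝ := fun k => ∑ i, Polynomial.C (a k i) * Polynomial.X ^ (e i : ℕ)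
  have hp : ∀ k, p k ≠ 0 := by
    intro k hk
    apply ha k
    funext i
    have h : (p k).coeff (e i) = a k i := by
      simp only [p, Polynomial.finsetSum_coeff, Polynomial.coeff_C_mul, Polynomial.coeff_X_pow]
      rw [Finset.sum_eq_single i]
      · simp
      · intro j _ hj
        rw [if_neg]
        · simp
        · intro h
          exact hj (e.injective (Fin.ext h)).symm
      · simp
    rw [← h, hk]
    simp
  have hfin : (⋃ k, {t : ℝ | (p k).IsRoot t}).Finite :=
    Set.finite_iUnion fun k => Polynomial.finite_setOfPred_isRoot (hp k)
  obtain ⟨t, ht, htn⟩ := (Set.Ioi_infinite (0 : ℝ)).exists_notMem_finite hfin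
  refine ⟨fun i => t ^ (e i : ℕ), fun i => pow_pos ht _, fun k hk => htn ?_⟩
  refine Set.mem_iUnion.2 ⟨k, ?_⟩
  simp only [Set.mem_ofPred_eq, Polynomial.IsRoot, p, Polynomial.eval_finsetSum,
    Polynomial.eval_mul, Polynomial.eval_C, Polynomial.eval_pow, Polynomial.eval_X]
  rw [← hk]
  exact Finset.sum_congr rfl fun i _ => mul_comm _ _

/-- `c` is the system of coordinates with respect to a basis `v i`, `i ∈ B`, extended by zero. -/
def IsCoord {E ι : Type*} [AddCommGroup E] [Module ℝ E] [Fintype ι] (v : ι → E) (B : Finset ι)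
    (c : ι → E →ₗ[ℝ] ℝ) : Prop :=
  (∀ i, i ∉ B → c i = 0) ∧ (∀ x, ∑ i, c i x • v i = x) ∧
    ∀ μ : ι → ℝ, (∀ i, i ∉ B → μ i = 0) → ∀ i, c i (∑ j, μ j • v j) = μ i

section

variable {E ι : Type*} [AddCommGroup E] [Module ℝ E] [Fintype ι]

lemma exists_isCoord (v : ι → E) (B : Finset ι) (hli : LinearIndepOn ℝ v (B : Set ι))
    (hsp : Submodule.span ℝ (v '' (B : Set ι)) = ⊤) : ∃ c, IsCoord v B c := by
  classical
  let b : Module.Basis B ℝ E := Module.Basis.mk hli (by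
    rw [← hsp]
    apply Submodule.span_mono
    rintro _ ⟨i, hi, rfl⟩
    exact ⟨⟨i, hi⟩, rfl⟩)
  have hb : ∀ i : B, b i = v i := fun i => by simp [b]
  have hsum : ∀ f : ι → E, (∀ i, i ∉ B → f i = 0) → ∑ i, f i = ∑ i : B, f i := by
    intro f hf
    rw [← Finset.sum_coe_sort B f |>.symm]
    exact (Finset.sum_subset (Finset.subset_univ B) fun i _ hi => hf i hi).symm
  refine ⟨fun i => if h : i ∈ B then b.coord ⟨i, h⟩ else 0, ?_, ?_, ?_⟩
  · intro i hi
    simp [hi]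
  · intro x
    rw [hsum]
    · conv_rhs => rw [← b.sum_repr x]
      exact Finset.sum_congr rfl fun i _ => by simp [hb]
    · intro i hi
      simp [hi]
  · intro μ hμ i
    rw [hsum _ (fun i hi => by simp [hμ i hi])]
    by_cases h : i ∈ B
    · simp only [h, dite_true]
      have : ∑ i : B, μ i • v i = ∑ i : B, μ i • b i := by simp [hb]
      rw [this]
      simp only [Module.Basis.coord_apply]
      rw [Module.Basis.repr_sum_self b (fun i : B => μ i)]
    · simp [h, hμ i h]

lemma IsCoord.apply_self {v : ι → E} {B : Finset ι} {c : ι → E →ₗ[ℝ] ℝ} (h : IsCoord v B c)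
    [DecidableEq ι] {i : ι} (hi : i ∈ B) (j : ι) : c j (v i) = if j = i then 1 else 0 := by
  have := h.2.2 (fun j => if j = i then 1 else 0) (by
    intro k hk
    rw [if_neg]
    rintro rfl
    exact hk hi) j
  simpa using this

lemma exists_small_pos {α : Type*} [Finite α] (P : α → ℝ → Prop)
    (h : ∀ a, ∀ᶠ t in nhdsWithin (0 : ℝ) (Set.Ioi 0), P a t) : ∃ t > 0, ∀ a, P a t := by
  have := (Filter.eventually_all.2 h).and self_mem_nhdsWithin
  obtain ⟨t, ht, h0⟩ := this.exists
  exact ⟨t, h0, ht⟩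

lemma eventually_add_mul_pos {x a : ℝ} (h : 0 < x ∨ (x = 0 ∧ 0 < a)) :
    ∀ᶠ t in nhdsWithin (0 : ℝ) (Set.Ioi 0), 0 < x + t * a := by
  rcases h with h | ⟨rfl, h⟩
  · have : Filter.Tendsto (fun t : ℝ => x + t * a) (nhds 0) (nhds (x + 0 * a)) := by
      apply Continuous.tendsto
      fun_prop
    rw [zero_mul, add_zero] at this
    exact (this.eventually (lt_mem_nhds h)).filter_mono nhdsWithin_le_nhds
  · filter_upwards [self_mem_nhdsWithin] with t ht
    rw [zero_add]
    exact mul_pos ht h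

/-- The cone generated by the vectors `v i`. -/
def conicHull (v : ι → E) : Set E := {x | ∃ μ : ι → ℝ, (∀ i, 0 ≤ μ i) ∧ ∑ i, μ i • v i = x}

/-- The combinations of the vectors `v i` with positive coefficients. -/
def posHull (v : ι → E) : Set E := {x | ∃ μ : ι → ℝ, (∀ i, 0 < μ i) ∧ ∑ i, μ i • v i = x}

lemma exists_base_of_generic (v : ι → E) (hsp : Submodule.span ℝ (Set.range v) = ⊤)
    (ht : E →ₗ[ℝ] ℝ) (hht : ∀ i, ht (v i) = 1) (c : Finset ι → ι → E →ₗ[ℝ] ℝ)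
    (hc : ∀ B : Finset ι, LinearIndepOn ℝ v (B : Set ι) →
      Submodule.span ℝ (v '' (B : Set ι)) = ⊤ → IsCoord v B (c B))
    (w : ι → ℝ)
    (hw : ∀ B, IsCoord v B (c B) → ∀ i, i ∉ B → w i - ∑ j, w j * c B j (v i) ≠ 0)
    {y : E} (hy : y ∈ conicHull v)
    (hgen : ∀ B, IsCoord v B (c B) → ∀ i ∈ B, c B i y ≠ 0) :
    ∃ B, IsCoord v B (c B) ∧ (∀ i, i ∉ B → ∑ j, w j * c B j (v i) < w i) ∧
      ∀ i ∈ B, 0 < c B i y := by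
  classical
  let K : Set (ι → ℝ) := {μ | (∀ i, 0 ≤ μ i) ∧ ∑ i, μ i • v i = y}
  have hfd : FiniteDimensional ℝ E :=
    ⟨⟨Finset.univ.image v, by simpa using hsp⟩⟩
  have hKht : ∀ μ : ι → ℝ, ∑ i, μ i • v i = y → ∑ i, μ i = ht y := by
    intro μ h
    rw [← h]
    simp [hht]
  let b := Module.finBasis ℝ E
  have hKeq : K = {μ | (∀ i, 0 ≤ μ i) ∧ ∀ k, ∑ i, μ i * b.repr (v i) k = b.repr y k} := by
    ext μ
    refine and_congr_right fun _ => ?_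
    constructor
    · intro h k
      rw [← h]
      simp
    · intro h
      apply b.repr.injective
      ext k
      rw [← h k]
      simp
  have hKclosed : IsClosed K := by
    rw [hKeq, Set.ofPred_and]
    refine IsClosed.inter ?_ ?_
    · rw [Set.ofPred_forall]
      exact isClosed_iInter fun i => isClosed_le continuous_const (continuous_apply i)
    · rw [Set.ofPred_forall]
      exact isClosed_iInter fun k => isClosed_eq (by fun_prop) continuous_const
  have hKsub : K ⊆ Set.Icc 0 (fun _ => ht y) := by
    rintro μ ⟨h0, h1⟩
    refine ⟨fun i => h0 i, fun i => ?_⟩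
    rw [← hKht μ h1]
    exact Finset.single_le_sum (fun j _ => h0 j) (Finset.mem_univ i)
  have hKc : IsCompact K := isCompact_Icc.of_isClosed_subset hKclosed hKsub
  obtain ⟨μ₀, h₀, h₀'⟩ := hy
  obtain ⟨l, ⟨hl0, hly⟩, hmin⟩ := hKc.exists_isMinOn ⟨μ₀, h₀, h₀'⟩
    (f := fun μ : ι → ℝ => ∑ i, w i * μ i) (by fun_prop)
  have hdir : ∀ a : ι → ℝ, ∑ i, a i • v i = 0 → (∀ i, a i < 0 → 0 < l i) →
      0 ≤ ∑ i, w i * a i := by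
    intro a ha ha'
    obtain ⟨t, ht0, ht⟩ := exists_small_pos (fun i t => 0 ≤ l i + t * a i) (by
      intro i
      rcases lt_or_ge (a i) 0 with h | h
      · exact (eventually_add_mul_pos (Or.inl (ha' i h))).mono fun t h => h.le
      · filter_upwards [self_mem_nhdsWithin] with t ht
        have := hl0 i
        have : 0 ≤ t * a i := mul_nonneg (le_of_lt ht) h
        linarith)
    have hmem : (fun i => l i + t * a i) ∈ K := by
      refine ⟨ht, ?_⟩
      simp only [add_smul, mul_smul, Finset.sum_add_distrib, ← Finset.smul_sum, ha, hly]
      simp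
    have := hmin hmem
    simp only [Set.mem_ofPred_eq, mul_add, Finset.sum_add_distrib] at this
    have h2 : ∑ i, w i * (t * a i) = t * ∑ i, w i * a i := by
      rw [Finset.mul_sum]
      exact Finset.sum_congr rfl fun i _ => by ring
    rw [h2] at this
    have : 0 ≤ t * ∑ i, w i * a i := by linarith
    exact nonneg_of_mul_nonneg_right this ht0
  let rel : Finset ι → ι → ι → ℝ := fun B i j => (if j = i then 1 else 0) - c B j (v i)
  have hrel0 : ∀ B, IsCoord v B (c B) → ∀ i, ∑ j, rel B i j • v j = 0 := by
    intro B hB i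
    simp only [rel, sub_smul, Finset.sum_sub_distrib, hB.2.1]
    simp
  have hrelw : ∀ B i, ∑ j, w j * rel B i j = w i - ∑ j, w j * c B j (v i) := by
    intro B i
    simp [rel, mul_sub]
  let S : Set ι := {i | 0 < l i}
  obtain ⟨S₀, hS₀S, -, hS₀sp, hS₀li⟩ :=
    exists_linearIndepOn_extension (linearIndepOn_empty ℝ v) (Set.empty_subset S)
  obtain ⟨B', -, hB'S, hB'sp, hB'li⟩ :=
    exists_linearIndepOn_extension hS₀li (Set.subset_univ S₀)
  obtain ⟨B, rfl⟩ : ∃ B : Finset ι, (B : Set ι) = B' := ⟨B'.toFinite.toFinset, by simp⟩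
  have hBsp : Submodule.span ℝ (v '' (B : Set ι)) = ⊤ := by
    rw [eq_top_iff, ← hsp]
    rw [Set.image_univ] at hB'sp
    exact Submodule.span_le.2 hB'sp
  have hB := hc B hB'li hBsp
  have hSB : S ⊆ B := by
    intro i hi
    by_contra hiB
    have hspan := hS₀sp ⟨i, hi, rfl⟩
    obtain ⟨S₁, rfl⟩ : ∃ T : Finset ι, (T : Set ι) = S₀ := ⟨S₀.toFinite.toFinset, by simp⟩
    rw [SetLike.mem_coe, Submodule.mem_span_image_finset_iff_exists_fun] at hspan
    obtain ⟨d₀, hd₀⟩ := hspan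
    obtain ⟨d, hd⟩ : ∃ d : ι → ℝ, ∑ j ∈ S₁, d j • v j = v i := by
      refine ⟨fun j => if h : j ∈ S₁ then d₀ ⟨j, h⟩ else 0, ?_⟩
      rw [← hd₀, ← Finset.sum_coe_sort]
      exact Finset.sum_congr rfl fun j _ => by simp
    have hcd : ∀ j, c B j (v i) = if j ∈ S₁ then d j else 0 := by
      intro j
      have := hB.2.2 (fun j => if j ∈ S₁ then d j else 0) (by
        intro k hk
        rw [if_neg]
        exact fun h => hk (hB'S h)) j
      rw [← this]
      congr 1
      rw [← hd]
      simp [ite_smul, Finset.sum_ite_mem]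
    have hsupp : ∀ j, rel B i j ≠ 0 → 0 < l j := by
      intro j hj
      by_cases hji : j = i
      · rw [hji]; exact hi
      · simp only [rel, hji, if_false, hcd, zero_sub] at hj
        by_cases h : j ∈ S₁
        · exact hS₀S h
        · simp [h] at hj
    have h1 := hdir (rel B i) (hrel0 B hB i) fun j hj => hsupp j hj.ne
    have h2 := hdir (fun j => - rel B i j) (by simp [hrel0 B hB i])
      fun j hj => hsupp j (by intro h; simp [h] at hj)
    simp only [mul_neg, Finset.sum_neg_distrib] at h2
    apply hw B hB i hiB
    rw [← hrelw]
    linarith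
  have hcl : ∀ i, c B i y = l i := by
    intro i
    rw [← hly]
    apply hB.2.2
    intro k hk
    by_contra h
    exact hk (hSB (lt_of_le_of_ne (hl0 k) (Ne.symm h)))
  have hpos : ∀ i ∈ B, 0 < l i := fun i hi =>
    lt_of_le_of_ne (hl0 i) (Ne.symm (by rw [← hcl]; exact hgen B hB i hi))
  refine ⟨B, hB, fun i hi => ?_, fun i hi => by rw [hcl]; exact hpos i hi⟩
  have h1 := hdir (rel B i) (hrel0 B hB i) (by
    intro j hj
    by_cases hjB : j ∈ B
    · exact hpos j hjB
    · simp only [rel, hB.1 j hjB, LinearMap.zero_apply, sub_zero] at hj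
      split_ifs at hj <;> linarith)
  rw [hrelw] at h1
  have := hw B hB i hi
  exact lt_of_le_of_ne (by linarith) (fun h => this (by linarith))

lemma base_unique (v : ι → E) (w : ι → ℝ) {B B' : Finset ι} {c c' : ι → E →ₗ[ℝ] ℝ}
    (hB : IsCoord v B c) (hB' : IsCoord v B' c')
    (hT : ∀ i, i ∉ B → ∑ j, w j * c j (v i) < w i)
    (hT' : ∀ i, i ∉ B' → ∑ j, w j * c' j (v i) < w i) {y : E}
    (hy : ∀ i ∈ B, 0 < c i y) (hy' : ∀ i ∈ B', 0 < c' i y) : B = B' := by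
  classical
  have key : ∀ {B B' : Finset ι} {c c' : ι → E →ₗ[ℝ] ℝ}, IsCoord v B c → IsCoord v B' c' →
      (∀ i, i ∉ B → ∑ j, w j * c j (v i) < w i) → (∀ i ∈ B', 0 < c' i y) →
      ∑ j, w j * c j y ≤ ∑ j, w j * c' j y ∧
      ((∃ i ∈ B', i ∉ B) → ∑ j, w j * c j y < ∑ j, w j * c' j y) := by
    intro B B' c c' hB hB' hT hy'
    have h1 : ∑ j, w j * c j y = ∑ i, c' i y * ∑ j, w j * c j (v i) := by
      conv_lhs => rw [← hB'.2.1 y]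
      simp only [map_sum, map_smul, smul_eq_mul, Finset.mul_sum]
      rw [Finset.sum_comm]
      exact Finset.sum_congr rfl fun i _ => Finset.sum_congr rfl fun j _ => by ring
    have hle : ∀ i, ∑ j, w j * c j (v i) ≤ w i := by
      intro i
      by_cases hi : i ∈ B
      · simp [hB.apply_self hi]
      · exact (hT i hi).le
    have hnn : ∀ i, 0 ≤ c' i y := by
      intro i
      by_cases hi : i ∈ B'
      · exact (hy' i hi).le
      · simp [hB'.1 i hi]
    rw [h1]
    constructor
    · refine Finset.sum_le_sum fun i _ => ?_
      rw [mul_comm (w i)]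
      exact mul_le_mul_of_nonneg_left (hle i) (hnn i)
    · rintro ⟨i, hi, hiB⟩
      refine Finset.sum_lt_sum (fun i _ => ?_) ⟨i, Finset.mem_univ i, ?_⟩
      · rw [mul_comm (w i)]
        exact mul_le_mul_of_nonneg_left (hle i) (hnn i)
      · rw [mul_comm (w i)]
        exact mul_lt_mul_of_pos_left (hT i hiB) (hy' i hi)
  have h1 := key hB hB' hT hy'
  have h2 := key hB' hB hT' hy
  by_contra hne
  rcases Finset.not_subset.1 (fun h => hne (h.antisymm (by
    by_contra h'
    obtain ⟨i, hi, hi'⟩ := Finset.not_subset.1 h'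
    have := h1.2 ⟨i, hi, hi'⟩
    linarith [h2.1]))) with ⟨i, hi, hi'⟩
  have := h2.2 ⟨i, hi, hi'⟩
  linarith [h1.1]

/-- A half-open triangulation of a cone. -/
theorem exists_halfOpen_triangulation (v : ι → E) (hsp : Submodule.span ℝ (Set.range v) = ⊤)
    (ht : E →ₗ[ℝ] ℝ) (hht : ∀ i, ht (v i) = 1) :
    ∃ (T : Finset (Finset ι)) (c : Finset ι → ι → E →ₗ[ℝ] ℝ) (q : E),
      (∀ B ∈ T, IsCoord v B (c B)) ∧ q ∈ posHull v ∧ (∀ B ∈ T, ∀ i ∈ B, c B i q ≠ 0) ∧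
      ∀ x ∈ conicHull v, ∃! B, B ∈ T ∧ ∀ i ∈ B, 0 < c B i x ∨ (c B i x = 0 ∧ 0 < c B i q) := by
  classical
  have : ∀ B : Finset ι, ∃ c, LinearIndepOn ℝ v (B : Set ι) →
      Submodule.span ℝ (v '' (B : Set ι)) = ⊤ → IsCoord v B c := by
    intro B
    by_cases h : LinearIndepOn ℝ v (B : Set ι) ∧ Submodule.span ℝ (v '' (B : Set ι)) = ⊤
    · obtain ⟨c, hc⟩ := exists_isCoord v B h.1 h.2
      exact ⟨c, fun _ _ => hc⟩
    · exact ⟨0, fun h1 h2 => (h ⟨h1, h2⟩).elim⟩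
  choose c hc using this
  obtain ⟨w, -, hw⟩ := exists_pos_generic
    (κ := {p : Finset ι × ι // IsCoord v p.1 (c p.1) ∧ p.2 ∉ p.1})
    (fun p j => (if j = p.1.2 then 1 else 0) - c p.1.1 j (v p.1.2)) (by
      rintro ⟨⟨B, i⟩, hB, hi⟩ h
      have := congrFun h i
      simp [hB.1 i hi] at this)
  obtain ⟨u, hu0, hu⟩ := exists_pos_generic
    (κ := {p : Finset ι × ι // IsCoord v p.1 (c p.1) ∧ p.2 ∈ p.1})
    (fun p j => c p.1.1 p.1.2 (v j)) (by
      rintro ⟨⟨B, i⟩, hB, hi⟩ h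
      have := congrFun h i
      simp [hB.apply_self hi] at this)
  have hw' : ∀ B, IsCoord v B (c B) → ∀ i, i ∉ B → w i - ∑ j, w j * c B j (v i) ≠ 0 := by
    intro B hB i hi
    have := hw ⟨(B, i), hB, hi⟩
    simpa [mul_sub] using this
  let q : E := ∑ i, u i • v i
  have hq : ∀ B, IsCoord v B (c B) → ∀ i ∈ B, c B i q ≠ 0 := by
    intro B hB i hi
    have := hu ⟨(B, i), hB, hi⟩
    simpa [q] using this
  let T : Finset (Finset ι) := Finset.univ.filter fun B =>
    IsCoord v B (c B) ∧ ∀ i, i ∉ B → ∑ j, w j * c B j (v i) < w i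
  refine ⟨T, c, q, fun B hB => (Finset.mem_filter.1 hB).2.1, ⟨u, hu0, rfl⟩,
    fun B hB => hq B (Finset.mem_filter.1 hB).2.1, ?_⟩
  rintro x ⟨μ, hμ, rfl⟩
  set x := ∑ i, μ i • v i
  obtain ⟨ε, hε, h⟩ := exists_small_pos
    (fun (p : {p : Finset ι × ι // IsCoord v p.1 (c p.1) ∧ p.2 ∈ p.1}) (t : ℝ) =>
      c p.1.1 p.1.2 x + t * c p.1.1 p.1.2 q ≠ 0 ∧ (0 < c p.1.1 p.1.2 x + t * c p.1.1 p.1.2 q ↔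
        0 < c p.1.1 p.1.2 x ∨ (c p.1.1 p.1.2 x = 0 ∧ 0 < c p.1.1 p.1.2 q))) (by
    rintro ⟨⟨B, i⟩, hB, hi⟩
    have hqi := hq B hB i hi
    dsimp only at hqi ⊢
    by_cases hpos : 0 < c B i x ∨ (c B i x = 0 ∧ 0 < c B i q)
    · exact (eventually_add_mul_pos hpos).mono fun t h => ⟨h.ne', by simp [h, hpos]⟩
    · have hneg : 0 < -c B i x ∨ (-c B i x = 0 ∧ 0 < -c B i q) := by
        push Not at hpos
        rcases lt_or_eq_of_le hpos.1 with h | h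
        · left; linarith
        · right; exact ⟨by linarith, by have := lt_of_le_of_ne (hpos.2 h) hqi; linarith⟩
      refine (eventually_add_mul_pos hneg).mono fun t h => ?_
      have : c B i x + t * c B i q < 0 := by linarith
      exact ⟨this.ne, by simp only [hpos, iff_false]; linarith⟩)
  have hyc : x + ε • q ∈ conicHull v := by
    refine ⟨fun i => μ i + ε * u i, fun i => ?_, ?_⟩
    · have := hμ i
      have := hu0 i
      positivity
    · simp only [add_smul, mul_smul, Finset.sum_add_distrib, ← Finset.smul_sum, x, q]
  have hsign : ∀ B, IsCoord v B (c B) → ((∀ i ∈ B, 0 < c B i (x + ε • q)) ↔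
      ∀ i ∈ B, 0 < c B i x ∨ (c B i x = 0 ∧ 0 < c B i q)) := by
    intro B hB
    refine forall₂_congr fun i hi => ?_
    have := (h ⟨(B, i), hB, hi⟩).2
    simpa using this
  obtain ⟨B, hB, hBT, hBy⟩ := exists_base_of_generic v hsp ht hht c hc w hw' hyc (by
    intro B hB i hi
    have := (h ⟨(B, i), hB, hi⟩).1
    simpa using this)
  refine ⟨B, ⟨Finset.mem_filter.2 ⟨Finset.mem_univ _, hB, hBT⟩, (hsign B hB).1 hBy⟩, ?_⟩
  rintro B' ⟨hB'T, hB'x⟩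
  obtain ⟨-, hB', hB'T⟩ := Finset.mem_filter.1 hB'T
  exact base_unique v w hB' hB hB'T hBT ((hsign B' hB').2 hB'x) hBy

end

section

variable {E ι : Type*} [AddCommGroup E] [Module ℝ E] [Fintype ι]

lemma IsCoord.card_eq {v : ι → E} {B : Finset ι} {c : ι → E →ₗ[ℝ] ℝ} (h : IsCoord v B c) :
    B.card = Module.finrank ℝ E := by
  classical
  let f : E →ₗ[ℝ] (B → ℝ) := LinearMap.pi fun i => c i
  have hf : Function.Bijective f := by
    constructor
    · rw [injective_iff_map_eq_zero]
      intro x hx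
      rw [← h.2.1 x]
      refine Finset.sum_eq_zero fun i _ => ?_
      by_cases hi : i ∈ B
      · have : c i x = 0 := congrFun hx ⟨i, hi⟩
        rw [this, zero_smul]
      · rw [h.1 i hi]
        simp
    · intro μ
      refine ⟨∑ i, (if hi : i ∈ B then μ ⟨i, hi⟩ else 0) • v i, ?_⟩
      funext i
      have := h.2.2 (fun i => if hi : i ∈ B then μ ⟨i, hi⟩ else 0) (fun i hi => by simp [hi]) i
      simpa [f] using this
  have := (LinearEquiv.ofBijective f hf).finrank_eq
  rw [this]
  simp

lemma IsCoord.height_eq {v : ι → E} {B : Finset ι} {c : ι → E →ₗ[ℝ] ℝ} (h : IsCoord v B c)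
    {ht : E →ₗ[ℝ] ℝ} (hht : ∀ i, ht (v i) = 1) (x : E) : ht x = ∑ i, c i x := by
  conv_lhs => rw [← h.2.1 x]
  simp [hht]

/-- The lattice points of height `k` in a lattice cone are counted by a sum of binomial
coefficients whose shifts are bounded by the degree. -/
theorem exists_heights (v : ι → E) (hsp : Submodule.span ℝ (Set.range v) = ⊤)
    (ht : E →ₗ[ℝ] ℝ) (hht : ∀ i, ht (v i) = 1) (L : AddSubgroup E) (hL : ∀ i, v i ∈ L)
    (hint : ∀ x ∈ L, ∃ m : ℤ, ht x = m)
    (hfin : ∀ k : ℕ, {x | x ∈ L ∧ x ∈ conicHull v ∧ ht x = k}.Finite)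
    {j : ℕ} (hj : Module.finrank ℝ E = j + 1) {d : ℕ}
    (hd : ∀ x ∈ L, x ∈ posHull v → ∀ k : ℕ, ht x = k → j + 1 ≤ k + d) :
    ∃ M : Multiset ℕ, (∀ h ∈ M, h ≤ d) ∧ ∀ k : ℕ,
      {x | x ∈ L ∧ x ∈ conicHull v ∧ ht x = k}.ncard =
        (M.map fun h => if h ≤ k then (k - h + j).choose j else 0).sum := by
  classical
  obtain ⟨T, c, q, hT, hq, hq0, huniq⟩ := exists_halfOpen_triangulation v hsp ht hht
  have hLs : ∀ m : ι → ℕ, ∑ i, (m i : ℝ) • v i ∈ L := fun m =>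
    L.sum_mem fun i _ => by
      rw [Nat.cast_smul_eq_nsmul]
      exact L.nsmul_mem (hL i) _
  let Bx : Set (Finset ι × E) := {p | p.1 ∈ T ∧ p.2 ∈ L ∧ ∀ i ∈ p.1,
    (0 < c p.1 i q → 0 ≤ c p.1 i p.2 ∧ c p.1 i p.2 < 1) ∧
    (c p.1 i q < 0 → 0 < c p.1 i p.2 ∧ c p.1 i p.2 ≤ 1)}
  have hbox : ∀ p ∈ Bx, ∀ i, 0 ≤ c p.1 i p.2 ∧ c p.1 i p.2 ≤ 1 := by
    intro p hp i
    by_cases hi : i ∈ p.1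
    · rcases lt_or_gt_of_ne (hq0 p.1 hp.1 i hi) with h | h
      · have := (hp.2.2 i hi).2 h
        exact ⟨this.1.le, this.2⟩
      · have := (hp.2.2 i hi).1 h
        exact ⟨this.1, this.2.le⟩
    · simp [(hT p.1 hp.1).1 i hi]
  have hHO : ∀ B ∈ T, ∀ x : E, (∀ i ∈ B, 0 < c B i x ∨ (c B i x = 0 ∧ 0 < c B i q)) →
      x ∈ conicHull v := by
    intro B hB x hx
    refine ⟨fun i => c B i x, fun i => ?_, (hT B hB).2.1 x⟩
    by_cases hi : i ∈ B
    · rcases hx i hi with h | h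
      · exact h.le
      · exact h.1.ge
    · simp [(hT B hB).1 i hi]
  have hnat : ∀ p ∈ Bx, ∃ n : ℕ, ht p.2 = n := by
    intro p hp
    obtain ⟨m, hm⟩ := hint p.2 hp.2.1
    have h0 : 0 ≤ ht p.2 := by
      rw [(hT p.1 hp.1).height_eq hht]
      exact Finset.sum_nonneg fun i _ => (hbox p hp i).1
    rw [hm] at h0
    lift m to ℕ using (by exact_mod_cast h0)
    exact ⟨m, by simpa using hm⟩
  have hBxfin : Bx.Finite := by
    refine Set.Finite.subset (T.finite_toSet.prod
      (Set.Finite.biUnion (Finset.range (Fintype.card ι + 1)).finite_toSet fun k _ => hfin k)) ?_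
    intro p hp
    refine ⟨hp.1, ?_⟩
    obtain ⟨n, hn⟩ := hnat p hp
    refine Set.mem_biUnion (x := n) ?_ ⟨hp.2.1, ?_, hn⟩
    · simp only [Finset.coe_range, Set.mem_Iio]
      have h1 : ht p.2 ≤ Fintype.card ι := by
        rw [(hT p.1 hp.1).height_eq hht]
        calc _ ≤ ∑ i : ι, (1 : ℝ) := Finset.sum_le_sum fun i _ => (hbox p hp i).2
          _ = _ := by simp
      rw [hn] at h1
      have : n ≤ Fintype.card ι := by exact_mod_cast h1
      omega
    · exact ⟨fun i => c p.1 i p.2, fun i => (hbox p hp i).1, (hT p.1 hp.1).2.1 _⟩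
  let hgt : Finset ι × E → ℕ := fun p => ⌊ht p.2⌋.toNat
  have hhgt : ∀ p ∈ Bx, ht p.2 = hgt p := by
    intro p hp
    obtain ⟨n, hn⟩ := hnat p hp
    simp [hgt, hn]
  let box := hBxfin.toFinset
  have hmem : ∀ p, p ∈ box ↔ p ∈ Bx := fun p => hBxfin.mem_toFinset
  refine ⟨box.val.map hgt, ?_, ?_⟩
  · intro h hh
    obtain ⟨p, hp, rfl⟩ := Multiset.mem_map.1 hh
    replace hp := (hmem p).1 hp
    have hB := hT p.1 hp.1
    let r : E := (∑ i ∈ p.1, v i) - p.2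
    have hrc : ∀ i ∈ p.1, c p.1 i r = 1 - c p.1 i p.2 := by
      intro i hi
      simp only [r, map_sub, map_sum]
      congr 1
      rw [Finset.sum_eq_single i]
      · simp [hB.apply_self hi]
      · intro b hb hbi
        rw [hB.apply_self hb, if_neg (Ne.symm hbi)]
      · exact fun h => (h hi).elim
    have hrL : r ∈ L := L.sub_mem (L.sum_mem fun i _ => hL i) hp.2.1
    obtain ⟨ε, hε, hr⟩ := exists_small_pos
      (fun (i : p.1) (t : ℝ) => 0 < c p.1 i r + t * - c p.1 i q) (by
      rintro ⟨i, hi⟩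
      apply eventually_add_mul_pos
      dsimp only
      rw [hrc i hi]
      rcases lt_or_gt_of_ne (hq0 p.1 hp.1 i hi) with h | h
      · have := (hp.2.2 i hi).2 h
        rcases this.2.lt_or_eq with h' | h'
        · left; linarith
        · right; constructor <;> linarith
      · have := (hp.2.2 i hi).1 h
        left; linarith)
    obtain ⟨u, hu, hqu⟩ := hq
    have hrpos : r ∈ posHull v := by
      refine ⟨fun i => c p.1 i (r - ε • q) + ε * u i, fun i => ?_, ?_⟩
      · have h1 : 0 ≤ c p.1 i (r - ε • q) := by
          by_cases hi : i ∈ p.1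
          · have := hr ⟨i, hi⟩
            simp only [map_sub, map_smul, smul_eq_mul]
            dsimp only at this
            linarith
          · simp [hB.1 i hi]
        have := mul_pos hε (hu i)
        linarith
      · simp only [add_smul, mul_smul, Finset.sum_add_distrib, ← Finset.smul_sum, hqu, hB.2.1]
        simp
    have hht' : ht r = (j + 1 : ℝ) - hgt p := by
      simp only [r, map_sub, map_sum, hht, ← hhgt p hp]
      simp only [Finset.sum_const, nsmul_eq_mul, mul_one, hB.card_eq, hj]
      push_cast
      ring
    obtain ⟨m, hm⟩ := hint r hrL
    have hr0 : 0 ≤ ht r := by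
      obtain ⟨μ, hμ, hμr⟩ := hrpos
      rw [← hμr]
      simp only [map_sum, map_smul, hht, smul_eq_mul, mul_one]
      exact Finset.sum_nonneg fun i _ => (hμ i).le
    rw [hm] at hr0
    lift m to ℕ using (by exact_mod_cast hr0)
    have h1 := hd r hrL hrpos m (by simpa using hm)
    rw [hm] at hht'
    have h2 : (m : ℝ) + hgt p = j + 1 := by
      push_cast at hht'
      linarith
    have h3 : m + hgt p = j + 1 := by exact_mod_cast h2
    omega
  · intro k
    rw [Multiset.map_map]
    let D : Finset (Σ _ : Finset ι × E, ι →₀ ℕ) := box.sigma fun p =>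
      if hgt p ≤ k then Finset.finsuppAntidiag p.1 (k - hgt p) else ∅
    have hD : D.card = ((box.val.map
        ((fun h => if h ≤ k then (k - h + j).choose j else 0) ∘ hgt)).sum) := by
      rw [Finset.card_sigma]
      refine Finset.sum_congr rfl fun p hp => ?_
      replace hp := (hmem p).1 hp
      simp only [Function.comp]
      split_ifs with h
      · rw [Finset.card_finsuppAntidiag_nat_eq_choose, (hT p.1 hp.1).card_eq, hj,
          show j + 1 + (k - hgt p) - 1 = (k - hgt p) + j by omega]
        exact Nat.choose_symm_add
      · simp
    have hDmem : ∀ p m, (⟨p, m⟩ : Σ _ : Finset ι × E, ι →₀ ℕ) ∈ D ↔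
        p ∈ Bx ∧ (∀ i, i ∉ p.1 → m i = 0) ∧ (∑ i, m i) + hgt p = k := by
      intro p m
      simp only [D, Finset.mem_sigma, hmem]
      refine and_congr_right fun hp => ?_
      have hsupp : (∀ i, i ∉ p.1 → m i = 0) ↔ m.support ⊆ p.1 := by
        constructor
        · intro h i hi
          by_contra h'
          exact Finsupp.mem_support_iff.1 hi (h i h')
        · intro h i hi
          by_contra h'
          exact hi (h (Finsupp.mem_support_iff.2 h'))
      have hsum : (∀ i, i ∉ p.1 → m i = 0) → ∑ i, m i = p.1.sum m := fun h =>
        (Finset.sum_subset (Finset.subset_univ _) fun i _ hi => h i hi).symm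
      split_ifs with h
      · rw [Finset.mem_finsuppAntidiag, ← hsupp]
        constructor
        · rintro ⟨h1, h2⟩
          refine ⟨h2, ?_⟩
          rw [hsum h2, h1]
          omega
        · rintro ⟨h1, h2⟩
          rw [hsum h1] at h2
          exact ⟨by omega, h1⟩
      · simp only [Finset.notMem_empty, false_iff]
        rintro ⟨-, h2⟩
        omega
    rw [← hD, ← Set.ncard_coe_finset]
    symm
    have hcoord : ∀ p ∈ Bx, ∀ m : ι →₀ ℕ, (∀ i, i ∉ p.1 → m i = 0) → ∀ i,
        c p.1 i (p.2 + ∑ i, (m i : ℝ) • v i) = c p.1 i p.2 + m i := by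
      intro p hp m hm i
      rw [map_add, (hT p.1 hp.1).2.2 (fun i => (m i : ℝ)) (fun i hi => by simp [hm i hi])]
    have hΦHO : ∀ p ∈ Bx, ∀ m : ι →₀ ℕ, (∀ i, i ∉ p.1 → m i = 0) → ∀ i ∈ p.1,
        0 < c p.1 i (p.2 + ∑ i, (m i : ℝ) • v i) ∨
          (c p.1 i (p.2 + ∑ i, (m i : ℝ) • v i) = 0 ∧ 0 < c p.1 i q) := by
      intro p hp m hm i hi
      rw [hcoord p hp m hm]
      have hm0 : (0 : ℝ) ≤ m i := Nat.cast_nonneg _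
      rcases lt_or_gt_of_ne (hq0 p.1 hp.1 i hi) with h | h
      · have := (hp.2.2 i hi).2 h
        left; linarith
      · have := (hp.2.2 i hi).1 h
        rcases (add_nonneg this.1 hm0).lt_or_eq with h' | h'
        · exact Or.inl h'
        · exact Or.inr ⟨h'.symm, h⟩
    refine Set.ncard_congr (fun a _ => a.1.2 + ∑ i, (a.2 i : ℝ) • v i) ?_ ?_ ?_
    · rintro ⟨p, m⟩ hpm
      obtain ⟨hp, hm, hk⟩ := (hDmem p m).1 hpm
      refine ⟨L.add_mem hp.2.1 (hLs m), hHO p.1 hp.1 _ (hΦHO p hp m hm), ?_⟩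
      simp only [map_add, map_sum, map_smul, hht, hhgt p hp, smul_eq_mul, mul_one]
      rw [← hk]
      push_cast
      ring
    · rintro ⟨⟨B, p⟩, m⟩ ⟨⟨B', p'⟩, m'⟩ hpm hpm' heq
      obtain ⟨hp, hm, -⟩ := (hDmem _ m).1 hpm
      obtain ⟨hp', hm', -⟩ := (hDmem _ m').1 hpm'
      dsimp only at heq
      have h1 := hΦHO _ hp m hm
      have h2 := hΦHO _ hp' m' hm'
      dsimp only at h1 h2
      rw [← heq] at h2
      obtain rfl : B = B' :=
        (huniq _ (hHO B hp.1 _ h1)).unique ⟨hp.1, h1⟩ ⟨hp'.1, h2⟩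
      have hmm : m = m' := by
        ext i
        by_cases hi : i ∈ B
        · have e1 := hcoord _ hp m hm i
          have e2 := hcoord _ hp' m' hm' i
          dsimp only at e1 e2
          rw [heq, e2] at e1
          have hlt : |c B i p' - c B i p| < 1 := by
            rw [abs_lt]
            rcases lt_or_gt_of_ne (hq0 B hp.1 i hi) with h | h
            · have a1 := (hp.2.2 i hi).2 h
              have a2 := (hp'.2.2 i hi).2 h
              dsimp only at a1 a2
              constructor <;> linarith
            · have a1 := (hp.2.2 i hi).1 h
              have a2 := (hp'.2.2 i hi).1 h
              dsimp only at a1 a2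
              constructor <;> linarith
          have e3 : c B i p' - c B i p = ((m i : ℤ) - (m' i : ℤ) : ℤ) := by
            push_cast
            linarith
          rw [e3] at hlt
          have e4 : |(m i : ℤ) - (m' i : ℤ)| < 1 := by exact_mod_cast hlt
          rw [Int.abs_lt_one_iff] at e4
          omega
        · rw [hm i hi, hm' i hi]
      subst hmm
      have : p = p' := by simpa using heq
      rw [this]
    · rintro x ⟨hxL, hxc, hxk⟩
      obtain ⟨B, ⟨hBT, hBx⟩, -⟩ := huniq x hxc
      have hB := hT B hBT
      let m : ι → ℕ := fun i =>
        if i ∈ B then (if 0 < c B i q then ⌊c B i x⌋.toNat else (⌈c B i x⌉ - 1).toNat) else 0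
      let p : E := x - ∑ i, (m i : ℝ) • v i
      have hcp : ∀ i, c B i p = c B i x - m i := by
        intro i
        simp only [p, map_sub]
        rw [hB.2.2 (fun i => (m i : ℝ)) (fun i hi => by simp [m, hi])]
      have hp : (B, p) ∈ Bx := by
        refine ⟨hBT, L.sub_mem hxL (hLs m), fun i hi => ⟨fun h => ?_, fun h => ?_⟩⟩
        · dsimp only
          rw [hcp]
          have h0 : 0 ≤ c B i x := by
            rcases hBx i hi with h | h
            · exact h.le
            · exact h.1.ge
          have e : (m i : ℝ) = (⌊c B i x⌋ : ℝ) := by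
            have : 0 ≤ ⌊c B i x⌋ := Int.floor_nonneg.2 h0
            simp only [m, hi, h, if_true]
            exact_mod_cast Int.toNat_of_nonneg this
          rw [e]
          have := Int.floor_le (c B i x)
          have := Int.lt_floor_add_one (c B i x)
          constructor <;> linarith
        · dsimp only
          rw [hcp]
          have h0 : 0 < c B i x := by
            rcases hBx i hi with h' | h'
            · exact h'
            · exact absurd h'.2 h.not_gt
          have e : (m i : ℝ) = (⌈c B i x⌉ : ℝ) - 1 := by
            have : 0 < ⌈c B i x⌉ := Int.ceil_pos.2 h0
            simp only [m, hi, h.not_gt, if_true, if_false]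
            have h2 : (((⌈c B i x⌉ - 1).toNat : ℕ) : ℤ) = ⌈c B i x⌉ - 1 :=
              Int.toNat_of_nonneg (by omega)
            exact_mod_cast h2
          rw [e]
          have := Int.le_ceil (c B i x)
          have := Int.ceil_lt_add_one (c B i x)
          constructor <;> linarith
      refine ⟨⟨(B, p), Finsupp.equivFunOnFinite.symm m⟩, ?_, ?_⟩
      · refine (hDmem _ _).2 ⟨hp, fun i hi => by simp [m, hi], ?_⟩
        have h1 := hhgt _ hp
        simp only [p, map_sub, map_sum, map_smul, hht, hxk, smul_eq_mul, mul_one] at h1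
        have h2 : (k : ℝ) = (∑ i, (m i : ℝ)) + hgt (B, p) := by
          simp only [p]
          linarith
        have h3 : k = ∑ i, m i + hgt (B, p) := by exact_mod_cast h2
        simpa using h3.symm
      · simp [p]

end

lemma sum_antidiagonal_alternating_choose (j s : ℕ) :
    ∑ p ∈ Finset.HasAntidiagonal.antidiagonal s, (-1 : ℝ) ^ p.1 * (j.choose p.1) * ((p.2 + j).choose j) = 1 := by
  have h1 : (1 - PowerSeries.X : PowerSeries ℝ) ^ j * (PowerSeries.mk 1) ^ (j + 1) =
      PowerSeries.mk 1 := by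
    rw [pow_succ, ← mul_assoc, ← mul_pow, mul_comm (1 - PowerSeries.X),
      PowerSeries.mk_one_mul_one_sub_eq_one, one_pow, one_mul]
  have h2 : (1 - PowerSeries.X : PowerSeries ℝ) ^ j =
      PowerSeries.mk fun n => (-1 : ℝ) ^ n * j.choose n := by
    have h := congrArg (PowerSeries.rescale (-1 : ℝ))
      (show ((1 + PowerSeries.X : PowerSeries ℝ) ^ j) =
        (((1 + Polynomial.X : Polynomial ℝ) ^ j : Polynomial ℝ) : PowerSeries ℝ) by simp)
    rw [map_pow, map_add, map_one, PowerSeries.rescale_X] at h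
    rw [show (1 - PowerSeries.X : PowerSeries ℝ) =
      1 + PowerSeries.C (-1 : ℝ) * PowerSeries.X by simp [sub_eq_add_neg], h]
    ext n
    rw [PowerSeries.coeff_rescale, Polynomial.coeff_coe, PowerSeries.coeff_mk,
      Polynomial.coeff_one_add_X_pow]
  have h3 := congrArg (PowerSeries.coeff s) h1
  rw [h2, PowerSeries.mk_one_pow_eq_mk_choose_add, PowerSeries.coeff_mul] at h3
  simp only [PowerSeries.coeff_mk, Pi.one_apply] at h3
  exact Eq.trans (Finset.sum_congr rfl fun p _ => by rw [add_comm p.2 j]) h3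

lemma sum_range_alternating_choose {h D : ℕ} (hD : h ≤ D) (j : ℕ) :
    ∑ i ∈ Finset.range (D + 1), (-1 : ℝ) ^ (D - i) * (j.choose (D - i)) *
      ((if h ≤ i then (i - h + j).choose j else 0 : ℕ) : ℝ) = 1 := by
  refine Eq.trans ?_ (sum_antidiagonal_alternating_choose j (D - h))
  rw [← Finset.sum_filter_add_sum_filter_not _ (fun i => h ≤ i)]
  rw [Finset.sum_eq_zero (s := Finset.filter (fun i => ¬ h ≤ i) _), add_zero]
  · symm
    refine Finset.sum_bij (fun p _ => p.2 + h) ?_ ?_ ?_ ?_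
    · intro p hp
      simp only [Finset.HasAntidiagonal.mem_antidiagonal, Finset.mem_filter, Finset.mem_range] at hp ⊢
      omega
    · intro p hp p' hp' e
      simp only [Finset.HasAntidiagonal.mem_antidiagonal] at hp hp'
      ext <;> omega
    · intro i hi
      simp only [Finset.mem_filter, Finset.mem_range] at hi
      exact ⟨(D - i, i - h), by simp only [Finset.HasAntidiagonal.mem_antidiagonal]; omega, by simp; omega⟩
    · intro p hp
      simp only [Finset.HasAntidiagonal.mem_antidiagonal] at hp
      have e1 : D - (p.2 + h) = p.1 := by omega
      simp [e1]
  · intro i hi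
    simp [(Finset.mem_filter.1 hi).2]

lemma tendsto_choose_div_pow (h j : ℕ) :
    Filter.Tendsto (fun k : ℕ => ((if h ≤ k then (k - h + j).choose j else 0 : ℕ) : ℝ) / k ^ j)
      Filter.atTop (nhds (1 / j.factorial)) := by
  have h1 : Filter.Tendsto (fun m : ℕ => ((m + j).choose j : ℝ) / (m + h : ℕ) ^ j)
      Filter.atTop (nhds (1 / j.factorial)) := by
    have e := (isEquivalent_choose j).comp_tendsto (Filter.tendsto_add_atTop_nat j)
    have hne : ∀ᶠ m : ℕ in Filter.atTop, ((m + j : ℕ) : ℝ) ^ j / j.factorial ≠ 0 := by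
      filter_upwards [Filter.eventually_gt_atTop 0] with m hm
      positivity
    have e' := (Asymptotics.isEquivalent_iff_tendsto_one (by simpa using hne)).1 e
    have h2 : Filter.Tendsto (fun m : ℕ => ((m + j : ℕ) : ℝ) / (m + h : ℕ)) Filter.atTop
        (nhds 1) := by
      have h3 : Filter.Tendsto (fun m : ℕ => (1 + ((j : ℝ) - h) / ((m + h : ℕ) : ℝ)))
          Filter.atTop (nhds (1 + 0)) := by
        refine tendsto_const_nhds.add ?_
        refine Filter.Tendsto.div_atTop tendsto_const_nhds ?_
        exact tendsto_natCast_atTop_atTop.comp (Filter.tendsto_add_atTop_nat h)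
      rw [add_zero] at h3
      refine h3.congr' ?_
      filter_upwards [Filter.eventually_gt_atTop 0] with m hm
      have : ((m + h : ℕ) : ℝ) ≠ 0 := by positivity
      field_simp
      push_cast
      ring
    have h4 := (e'.mul (h2.pow j)).mul_const (1 / (j.factorial : ℝ))
    simp only [one_pow, one_mul] at h4
    refine h4.congr' ?_
    filter_upwards [Filter.eventually_gt_atTop 0] with m hm
    have a1 : ((m + h : ℕ) : ℝ) ≠ 0 := by positivity
    have a2 : ((m + j : ℕ) : ℝ) ≠ 0 := by positivity
    simp only [Pi.div_apply, Function.comp, div_pow]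
    field_simp
  rw [← Filter.tendsto_add_atTop_iff_nat h]
  refine h1.congr fun m => ?_
  simp

/-- The leading coefficient of a combination of binomial coefficients, as an alternating sum of
its values. -/
lemma factorial_mul_limit_eq {M : Multiset ℕ} {N : ℕ → ℕ} {j d : ℕ} (hM : ∀ h ∈ M, h ≤ d)
    (hN : ∀ k, N k = (M.map fun h => if h ≤ k then (k - h + j).choose j else 0).sum)
    {V : ℝ} (hV : Filter.Tendsto (fun k : ℕ => (N k : ℝ) / k ^ j) Filter.atTop (nhds V))
    {D : ℕ} (hD : d ≤ D) :
    (j.factorial : ℝ) * V =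
      ∑ i ∈ Finset.range (D + 1), (-1 : ℝ) ^ (D - i) * (j.choose (D - i)) * N i := by
  have h1 : Filter.Tendsto (fun k : ℕ => (N k : ℝ) / k ^ j) Filter.atTop
      (nhds (Multiset.card M * (1 / j.factorial))) := by
    have : (fun k : ℕ => (N k : ℝ) / k ^ j) = fun k : ℕ => (M.map fun h =>
        ((if h ≤ k then (k - h + j).choose j else 0 : ℕ) : ℝ) / k ^ j).sum := by
      funext k
      rw [hN, Multiset.sum_map_div, Nat.cast_multiset_sum, Multiset.map_map]
      rfl
    rw [this]
    clear this hN hM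
    induction M using Multiset.induction with
    | empty => simp
    | cons a s ih =>
      simp only [Multiset.map_cons, Multiset.sum_cons, Multiset.card_cons, Nat.cast_add,
        Nat.cast_one, add_mul, one_mul]
      rw [add_comm]
      exact (tendsto_choose_div_pow a j).add ih
  rw [tendsto_nhds_unique hV h1]
  have h2 : (j.factorial : ℝ) * (Multiset.card M * (1 / j.factorial)) = Multiset.card M := by
    have : (j.factorial : ℝ) ≠ 0 := by positivity
    field_simp
  rw [h2]
  simp only [hN]
  clear hN hV h1 h2
  induction M using Multiset.induction with
  | empty => simp
  | cons a s ih =>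
    simp only [Multiset.map_cons, Multiset.sum_cons, Multiset.card_cons, Nat.cast_add,
      Nat.cast_one, mul_add, Finset.sum_add_distrib]
    rw [← ih fun h hh => hM h (Multiset.mem_cons_of_mem hh),
      sum_range_alternating_choose ((hM a (Multiset.mem_cons_self a s)).trans hD), add_comm]

lemma sum_powerset_alternating_choose {α : Type*} [DecidableEq α] (T : Finset α) :
    ∀ {N r : ℕ}, r < T.card → T.card ≤ N →
      ∑ S ∈ T.powerset, (-1 : ℝ) ^ S.card * ((N - S.card).choose r : ℝ) = 0 := by
  induction T using Finset.induction with
  | empty => intro N r h; simp at h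
  | insert a T ha ih =>
    intro N r hr hN
    rw [Finset.card_insert_of_notMem ha] at hr hN
    rw [Finset.sum_powerset_insert ha]
    obtain ⟨N, rfl⟩ : ∃ N', N = N' + 1 := ⟨N - 1, by omega⟩
    have h1 : ∀ S ∈ T.powerset, (-1 : ℝ) ^ (insert a S).card *
        ((N + 1 - (insert a S).card).choose r : ℝ) =
        - ((-1 : ℝ) ^ S.card * ((N - S.card).choose r : ℝ)) := by
      intro S hS
      rw [Finset.card_insert_of_notMem fun h => ha (Finset.mem_powerset.1 hS h)]
      rw [Nat.add_sub_add_right]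
      ring
    rw [Finset.sum_congr rfl h1, ← Finset.sum_add_distrib]
    cases r with
    | zero => simp
    | succ r =>
      rw [← ih (N := N) (r := r) (by omega) (by omega)]
      refine Finset.sum_congr rfl fun S hS => ?_
      have := Finset.card_le_card (Finset.mem_powerset.1 hS)
      rw [show N + 1 - S.card = (N - S.card) + 1 by omega, Nat.choose_succ_succ]
      push_cast
      ring

lemma latt_add {ι : Type*} (x y : ι → ℤ) : latt (x + y) = latt x + latt y := by
  ext; simp [latt]

lemma latt_sub {ι : Type*} (x y : ι → ℤ) : latt (x - y) = latt x - latt y := by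
  ext; simp [latt]

lemma latt_smul {ι : Type*} (k : ℤ) (x : ι → ℤ) : latt (k • x) = (k : ℝ) • latt x := by
  ext; simp [latt]

lemma latt_injective {ι : Type*} : Function.Injective (latt (ι := ι)) := by
  intro x y h
  ext i
  have := congrFun h i
  simpa [latt] using this

lemma mem_span_int_basisFun {ι : Type*} [Fintype ι] (x : ι → ℝ) :
    x ∈ Submodule.span ℤ (Set.range (Pi.basisFun ℝ ι)) ↔ ∃ z : ι → ℤ, x = latt z := by
  rw [(Pi.basisFun ℝ ι).mem_span_iff_repr_mem ℤ x]
  simp only [Pi.basisFun_repr, Set.mem_range]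
  constructor
  · intro h
    choose z hz using h
    exact ⟨z, funext fun i => (hz i).symm⟩
  · rintro ⟨z, rfl⟩ i
    exact ⟨z i, rfl⟩

lemma exists_isUnimodularParam {n j : ℕ} {F A : Set (Fin n → ℝ)} (hA : A.Nonempty)
    (hlat : ∀ a ∈ A, ∃ z, a = latt z) (hFA : affineSpan ℝ F = affineSpan ℝ A)
    (hj : Module.finrank ℝ (affineSpan ℝ F).direction = j) :
    ∃ φ : (Fin j → ℝ) →ᵃ[ℝ] (Fin n → ℝ), IsUnimodularParam F φ := by
  classical
  obtain ⟨a₀, ha₀⟩ := hA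
  obtain ⟨z₀, hz₀⟩ := hlat a₀ ha₀
  set W := (affineSpan ℝ F).direction with hW
  let L₀ := Submodule.span ℤ (Set.range (Pi.basisFun ℝ (Fin n)))
  let L : Submodule ℤ W := ZLattice.comap ℝ L₀ W.subtype
  have : DiscreteTopology L :=
    ZLattice.comap_discreteTopology ℝ L₀ W.subtypeL.continuous Subtype.val_injective
  have hmem : ∀ w : W, w ∈ L ↔ ∃ z, (w : Fin n → ℝ) = latt z := fun w =>
    mem_span_int_basisFun (w : Fin n → ℝ)
  have : IsZLattice ℝ L := by
    constructor
    rw [eq_top_iff]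
    rw [← Submodule.map_le_map_iff_of_injective (Submodule.injective_subtype W)]
    rw [Submodule.map_top, Submodule.range_subtype, Submodule.map_span]
    conv_lhs => rw [hW, hFA, direction_affineSpan, vectorSpan_eq_span_vsub_set_right ℝ ha₀]
    refine Submodule.span_mono ?_
    rintro _ ⟨a, ha, rfl⟩
    obtain ⟨z, hz⟩ := hlat a ha
    have hw : a -ᵥ a₀ ∈ W := by
      rw [hW, hFA, direction_affineSpan]
      exact vsub_mem_vectorSpan ℝ ha ha₀
    refine ⟨⟨_, hw⟩, ?_, rfl⟩
    refine (hmem _).2 ⟨z - z₀, ?_⟩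
    rw [latt_sub, ← hz, ← hz₀]; rfl
  have : Module.Finite ℤ L := ZLattice.module_finite ℝ L
  have : Module.Free ℤ L := ZLattice.module_free ℝ L
  have hr : Module.finrank ℤ L = j := by rw [ZLattice.rank ℝ L, hj]
  let b : Module.Basis (Fin j) ℤ L :=
    (Module.finBasisOfFinrankEq ℤ L hr)
  let B := b.ofZLatticeBasis ℝ L
  let f : (Fin j → ℝ) →ₗ[ℝ] (Fin n → ℝ) := W.subtype ∘ₗ B.equivFun.symm.toLinearMap
  have hf : Function.Injective f := Subtype.val_injective.comp B.equivFun.symm.injective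
  refine ⟨f.toAffineMap + AffineMap.const ℝ _ a₀, ?_, ?_, ?_⟩
  · intro x y h
    exact hf (by simpa using h)
  · ext y
    have h1 : y ∈ affineSpan ℝ F ↔ y - a₀ ∈ W := by
      have ha : a₀ ∈ affineSpan ℝ F := by rw [hFA]; exact subset_affineSpan ℝ _ ha₀
      exact (AffineSubspace.vsub_right_mem_direction_iff_mem ha y).symm
    rw [SetLike.mem_coe, h1]
    constructor
    · rintro ⟨x, rfl⟩
      have : (f.toAffineMap + AffineMap.const ℝ _ a₀ : (Fin j → ℝ) →ᵃ[ℝ] _) x - a₀ =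
          B.equivFun.symm x := by simp [f]
      rw [this]
      exact Subtype.coe_prop _
    · intro h
      exact ⟨B.equivFun ⟨_, h⟩, by simp [f]⟩
  · intro x
    have h2 : (∃ z, (f.toAffineMap + AffineMap.const ℝ _ a₀ : (Fin j → ℝ) →ᵃ[ℝ] _) x = latt z) ↔
        B.equivFun.symm x ∈ L := by
      rw [hmem]
      constructor
      · rintro ⟨z, hz⟩
        refine ⟨z - z₀, ?_⟩
        rw [latt_sub, ← hz, ← hz₀]
        simp [f]
      · rintro ⟨z, hz⟩
        refine ⟨z + z₀, ?_⟩
        rw [latt_add, ← hz, ← hz₀]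
        simp [f]
    rw [h2, ← b.ofZLatticeBasis_span ℝ, Module.Basis.mem_span_iff_repr_mem]
    have h3 : ∀ i, (b.ofZLatticeBasis ℝ L).repr (B.equivFun.symm x) i = x i := fun i => by
      change B.equivFun (B.equivFun.symm x) i = x i
      rw [LinearEquiv.apply_symm_apply]
    simp only [h3]
    constructor
    · rintro ⟨w, rfl⟩ i
      exact ⟨w i, rfl⟩
    · intro h
      choose w hw using h
      exact ⟨w, funext fun i => (hw i).symm⟩

lemma IsUnimodularParam.card_eq {n j : ℕ} {F : Set (Fin n → ℝ)}
    {φ : (Fin j → ℝ) →ᵃ[ℝ] (Fin n → ℝ)} (hφ : IsUnimodularParam F φ) {k : ℕ} (hk : k ≠ 0) :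
    Nat.card ↑(φ ⁻¹' F ∩ (k : ℝ)⁻¹ • (Submodule.span ℤ (Set.range (Pi.basisFun ℝ (Fin j))) :
      Set (Fin j → ℝ))) = {z : Fin n → ℤ | latt z ∈ (k : ℝ) • F}.ncard := by
  obtain ⟨hinj, hrange, hlat⟩ := hφ
  have hk' : (k : ℝ) ≠ 0 := by exact_mod_cast hk
  obtain ⟨z₀, hz₀⟩ := (hlat 0).1 ⟨0, by ext; simp [latt]⟩
  have hlin : ∀ x, φ ((k : ℝ) • x) + ((k - 1 : ℤ) : ℝ) • latt z₀ = (k : ℝ) • φ x := by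
    intro x
    have h1 : ∀ y, φ y = φ.linear y + φ 0 := fun y => by
      have := φ.decomp'
      have h := φ.map_vadd 0 y
      simpa using h
    rw [← hz₀, h1 (_ • x), h1 x, map_smul]
    push_cast
    module
  rw [Nat.card_coe_set_eq]
  have hz : ∀ x : Fin j → ℝ, (k : ℝ) • x ∈ Submodule.span ℤ (Set.range (Pi.basisFun ℝ (Fin j))) ↔
      ∃ z : Fin n → ℤ, (k : ℝ) • φ x = latt z := by
    intro x
    rw [mem_span_int_basisFun, hlat, ← hlin]
    constructor
    · rintro ⟨z, h⟩
      exact ⟨z + (k - 1 : ℤ) • z₀, by rw [latt_add, latt_smul, h]⟩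
    · rintro ⟨z, h⟩
      exact ⟨z - (k - 1 : ℤ) • z₀, by rw [latt_sub, latt_smul, ← h]; simp⟩
  rw [← Set.ncard_image_of_injective {z : Fin n → ℤ | latt z ∈ (k : ℝ) • F} latt_injective]
  have hg : Function.Injective fun x => (k : ℝ) • φ x := fun x y h =>
    hinj (smul_right_injective _ hk' h)
  rw [← Set.ncard_image_of_injective _ hg]
  congr 1
  ext y
  simp only [Set.mem_image, Set.mem_inter_iff, Set.mem_preimage, Set.mem_inv_smul_set_iff₀ hk',
    SetLike.mem_coe, hz]
  constructor
  · rintro ⟨x, ⟨h1, z, h2⟩, rfl⟩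
    exact ⟨z, by rw [Set.mem_ofPred_eq, ← h2]; exact Set.smul_mem_smul_set h1, h2.symm⟩
  · rintro ⟨z, hz, rfl⟩
    obtain ⟨f, hf, hfz⟩ := hz
    have : f ∈ Set.range φ := by rw [hrange]; exact subset_affineSpan ℝ _ hf
    obtain ⟨x, rfl⟩ := this
    exact ⟨x, ⟨hf, z, hfz⟩, hfz⟩

lemma IsUnimodularParam.tendsto_card {n j : ℕ} {F : Set (Fin n → ℝ)} (hF : Convex ℝ F)
    (hFc : IsCompact F) {φ : (Fin j → ℝ) →ᵃ[ℝ] (Fin n → ℝ)} (hφ : IsUnimodularParam F φ) :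
    Filter.Tendsto (fun k : ℕ => ({z : Fin n → ℤ | latt z ∈ (k : ℝ) • F}.ncard : ℝ) / k ^ j)
      Filter.atTop (nhds (volume (φ ⁻¹' F)).toReal) := by
  have hcont : Continuous φ := φ.continuous_of_finiteDimensional
  have hemb : Topology.IsClosedEmbedding φ := by
    have h : Topology.IsClosedEmbedding φ.linear :=
      LinearMap.isClosedEmbedding_of_injective
        (LinearMap.ker_eq_bot.2 ((AffineMap.linear_injective_iff φ).2 hφ.1))
    have h2 : (φ : (Fin j → ℝ) → _) = (Homeomorph.addRight (φ 0)) ∘ φ.linear := by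
      funext y
      have h := φ.map_vadd 0 y
      simpa using h
    rw [h2]
    exact (Homeomorph.addRight (φ 0)).isClosedEmbedding.comp h
  have hcomp : IsCompact (φ ⁻¹' F) := hemb.isCompact_preimage hFc
  have hconv : Convex ℝ (φ ⁻¹' F) := hF.affine_preimage φ
  have h := tendsto_card_div_pow_atTop_volume (φ ⁻¹' F) hcomp.isBounded
    hcomp.measurableSet (hconv.addHaar_frontier volume)
  refine h.congr' ?_
  filter_upwards [Filter.eventually_ne_atTop 0] with k hk
  rw [hφ.card_eq hk, Fintype.card_fin]

section Homogenization

variable {E : Type*} [AddCommGroup E] [Module ℝ E]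

/-- The span of `{(a, 1) | a ∈ A}`. -/
def homogSpan (A : Set E) : Submodule ℝ (E × ℝ) :=
  Submodule.span ℝ ((fun a : E => (a, (1 : ℝ))) '' A)

lemma homogSpan_eq_range {A : Set E} {a₀ : E} (ha₀ : a₀ ∈ A) :
    homogSpan A = LinearMap.range (LinearMap.prod
      ((vectorSpan ℝ A).subtype ∘ₗ LinearMap.fst ℝ _ ℝ +
        (LinearMap.snd ℝ (vectorSpan ℝ A) ℝ).smulRight a₀) (LinearMap.snd ℝ _ ℝ)) := by
  apply le_antisymm
  · refine Submodule.span_le.2 ?_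
    rintro _ ⟨a, ha, rfl⟩
    exact ⟨(⟨a -ᵥ a₀, vsub_mem_vectorSpan ℝ ha ha₀⟩, 1), by simp⟩
  · rintro _ ⟨⟨⟨w, hw⟩, t⟩, rfl⟩
    have h1 : vectorSpan ℝ A ≤ (homogSpan A).comap (LinearMap.inl ℝ E ℝ) := by
      rw [vectorSpan_eq_span_vsub_set_right ℝ ha₀]
      refine Submodule.span_le.2 ?_
      rintro _ ⟨a, ha, rfl⟩
      have : ((a, 1) : E × ℝ) - (a₀, 1) ∈ homogSpan A :=
        Submodule.sub_mem _ (Submodule.subset_span ⟨a, ha, rfl⟩)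
          (Submodule.subset_span ⟨a₀, ha₀, rfl⟩)
      simpa using this
    have h2 : ((w, 0) : E × ℝ) ∈ homogSpan A := h1 hw
    have h3 : t • ((a₀, 1) : E × ℝ) ∈ homogSpan A :=
      Submodule.smul_mem _ _ (Submodule.subset_span ⟨a₀, ha₀, rfl⟩)
    simpa using Submodule.add_mem _ h2 h3

lemma finrank_homogSpan [FiniteDimensional ℝ E] {A : Set E} (hA : A.Nonempty) :
    Module.finrank ℝ (homogSpan A) = Module.finrank ℝ (vectorSpan ℝ A) + 1 := by
  obtain ⟨a₀, ha₀⟩ := hA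
  rw [homogSpan_eq_range ha₀, LinearMap.finrank_range_of_inj, Module.finrank_prod,
    Module.finrank_self]
  intro x y h
  simp only [LinearMap.prod_apply, Function.prod_apply, LinearMap.add_apply, LinearMap.comp_apply,
    LinearMap.fst_apply, LinearMap.snd_apply, Submodule.subtype_apply, LinearMap.smulRight_apply,
    Prod.mk.injEq] at h
  have h2 := h.1
  rw [h.2, add_left_inj] at h2
  exact Prod.ext (Subtype.ext h2) h.2

lemma mem_smul_convexHull {A : Finset E} (hA : A.Nonempty) {t : ℝ} (ht : 0 ≤ t) {y : E} :
    y ∈ t • convexHull ℝ (A : Set E) ↔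
      ∃ μ : E → ℝ, (∀ a ∈ A, 0 ≤ μ a) ∧ ∑ a ∈ A, μ a = t ∧ ∑ a ∈ A, μ a • a = y := by
  constructor
  · rintro ⟨x, hx, rfl⟩
    obtain ⟨w, h1, h2, rfl⟩ := Finset.mem_convexHull'.1 hx
    refine ⟨fun a => t * w a, fun a ha => mul_nonneg ht (h1 a ha), ?_, ?_⟩
    · rw [← Finset.mul_sum, h2, mul_one]
    · simp only [mul_smul, ← Finset.smul_sum]
  · rintro ⟨μ, h1, h2, rfl⟩
    rcases ht.eq_or_lt with rfl | ht
    · obtain ⟨a, ha⟩ := hA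
      have h3 := (Finset.sum_eq_zero_iff_of_nonneg h1).1 h2
      refine ⟨a, subset_convexHull ℝ _ ha, ?_⟩
      simp only [zero_smul]
      exact (Finset.sum_eq_zero fun b hb => by rw [h3 b hb, zero_smul]).symm
    · refine ⟨∑ a ∈ A, (t⁻¹ * μ a) • a, Finset.mem_convexHull'.2 ⟨fun a => t⁻¹ * μ a,
        fun a ha => mul_nonneg (inv_nonneg.2 ht.le) (h1 a ha), ?_, rfl⟩, ?_⟩
      · rw [← Finset.mul_sum, h2, inv_mul_cancel₀ ht.ne']
      · simp only [mul_smul, ← Finset.smul_sum]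
        rw [smul_inv_smul₀ ht.ne']

end Homogenization

lemma finite_latt_mem {n : ℕ} {s : Set (Fin n → ℝ)} (hs : Bornology.IsBounded s) :
    {z : Fin n → ℤ | latt z ∈ s}.Finite := by
  obtain ⟨C, hC⟩ := hs.exists_norm_le
  refine (Set.finite_Icc (fun _ : Fin n => -⌈C⌉) (fun _ => ⌈C⌉)).subset fun z hz => ?_
  have h : ∀ i, |(z i : ℝ)| ≤ C := fun i => (norm_le_pi_norm (latt z) i).trans (hC _ hz)
  refine ⟨fun i => ?_, fun i => ?_⟩
  · have := (abs_le.1 (h i)).1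
    have h2 := Int.le_ceil C
    have : -(⌈C⌉ : ℝ) ≤ z i := by linarith
    exact_mod_cast this
  · have := (abs_le.1 (h i)).2.trans (Int.le_ceil C)
    exact_mod_cast this

/-- The number of lattice points in the `k`-th dilate. -/
def latticeCount {n : ℕ} (F : Set (Fin n → ℝ)) (k : ℕ) : ℕ :=
  {z : Fin n → ℤ | latt z ∈ (k : ℝ) • F}.ncard

lemma exists_multiset_latticeCount {n j d : ℕ} {A : Finset (Fin n → ℝ)} (hA : A.Nonempty)
    (hlat : ∀ a ∈ A, ∃ z, a = latt z)
    (hj : Module.finrank ℝ (vectorSpan ℝ (A : Set (Fin n → ℝ))) = j)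
    (hd : ∀ (k : ℕ) (z : Fin n → ℤ) (μ : (Fin n → ℝ) → ℝ), (∀ a ∈ A, 0 < μ a) →
      ∑ a ∈ A, μ a = k → ∑ a ∈ A, μ a • a = latt z → j + 1 ≤ k + d) :
    ∃ M : Multiset ℕ, (∀ h ∈ M, h ≤ d) ∧ ∀ k : ℕ,
      latticeCount (convexHull ℝ (A : Set (Fin n → ℝ))) k =
        (M.map fun h => if h ≤ k then (k - h + j).choose j else 0).sum := by
  classical
  let S := homogSpan (A : Set (Fin n → ℝ))
  let v : A → S := fun a => ⟨((a : Fin n → ℝ), 1), Submodule.subset_span ⟨a, a.2, rfl⟩⟩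
  have hsp : Submodule.span ℝ (Set.range v) = ⊤ := by
    have : Set.range v = (fun x : S => (x : (Fin n → ℝ) × ℝ)) ⁻¹'
        ((fun a => (a, (1 : ℝ))) '' (A : Set (Fin n → ℝ))) := by
      ext x
      constructor
      · rintro ⟨a, rfl⟩
        exact ⟨a, a.2, rfl⟩
      · rintro ⟨a, ha, h⟩
        exact ⟨⟨a, ha⟩, Subtype.ext h⟩
    rw [this]
    exact Submodule.span_span_coe_preimage
  let ht : S →ₗ[ℝ] ℝ := LinearMap.snd ℝ _ ℝ ∘ₗ S.subtype
  let L : AddSubgroup S :=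
    { carrier := {x | ∃ (z : Fin n → ℤ) (m : ℤ), (x : (Fin n → ℝ) × ℝ) = (latt z, (m : ℝ))}
      zero_mem' := ⟨0, 0, by ext <;> simp [latt]⟩
      add_mem' := by
        rintro x y ⟨z, m, h⟩ ⟨z', m', h'⟩
        exact ⟨z + z', m + m', by rw [Submodule.coe_add, h, h', latt_add]; simp⟩
      neg_mem' := by
        rintro x ⟨z, m, h⟩
        refine ⟨-z, -m, ?_⟩
        rw [Submodule.coe_neg, h]
        ext <;> simp [latt] }
  have hL : ∀ x, x ∈ L ↔ ∃ (z : Fin n → ℤ) (m : ℤ), (x : (Fin n → ℝ) × ℝ) = (latt z, (m : ℝ)) :=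
    fun x => Iff.rfl
  have hsum : ∀ μ : A → ℝ, ((∑ i, μ i • v i : S) : (Fin n → ℝ) × ℝ) =
      (∑ i, μ i • (i : Fin n → ℝ), ∑ i, μ i) := by
    intro μ
    rw [Submodule.coe_sum]
    ext <;> simp [v, Prod.fst_sum, Prod.snd_sum]
  have hext : ∀ μ : A → ℝ, ∃ μ' : (Fin n → ℝ) → ℝ, ∀ i : A, μ' i = μ i := fun μ =>
    ⟨fun x => if h : x ∈ A then μ ⟨x, h⟩ else 0, fun i => by simp⟩
  have himage : ∀ k : ℕ, (fun x : S => (x : (Fin n → ℝ) × ℝ).1) ''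
      {x | x ∈ L ∧ x ∈ conicHull v ∧ ht x = k} =
      latt '' {z : Fin n → ℤ | latt z ∈ (k : ℝ) • convexHull ℝ (A : Set (Fin n → ℝ))} := by
    intro k
    ext y
    constructor
    · rintro ⟨x, ⟨h1, ⟨μ, hμ, rfl⟩, h3⟩, rfl⟩
      obtain ⟨z, m, hz⟩ := (hL _).1 h1
      obtain ⟨μ', hμ'⟩ := hext μ
      have h3' : ∑ i, μ i = k := by
        have : ht (∑ i, μ i • v i) = ∑ i, μ i := by
          change ((∑ i, μ i • v i : S) : (Fin n → ℝ) × ℝ).2 = _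
          rw [hsum]
        rw [← this, h3]
      refine ⟨z, ?_, congrArg Prod.fst hz.symm⟩
      rw [Set.mem_ofPred_eq, mem_smul_convexHull hA (Nat.cast_nonneg k)]
      refine ⟨μ', fun a ha => ?_, ?_, ?_⟩
      · rw [hμ' ⟨a, ha⟩]; exact hμ _
      · rw [← h3', ← Finset.sum_coe_sort]
        exact Finset.sum_congr rfl fun i _ => hμ' i
      · rw [hsum] at hz
        refine Eq.trans ?_ (congrArg Prod.fst hz)
        rw [← Finset.sum_coe_sort]
        exact Finset.sum_congr rfl fun i _ => by rw [hμ' i]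
    · rintro ⟨z, hz, rfl⟩
      rw [Set.mem_ofPred_eq, mem_smul_convexHull hA (Nat.cast_nonneg k)] at hz
      obtain ⟨μ, h1, h2, h3⟩ := hz
      have e : ((∑ i : A, μ i • v i : S) : (Fin n → ℝ) × ℝ) = (latt z, (k : ℝ)) := by
        rw [hsum fun i : A => μ i, ← h2, ← h3, ← Finset.sum_coe_sort A, ← Finset.sum_coe_sort A]
      refine ⟨∑ i : A, μ i • v i, ⟨(hL _).2 ⟨z, k, by rw [e]; simp⟩,
        ⟨fun i => μ i, fun i => h1 i i.2, rfl⟩, ?_⟩, ?_⟩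
      · change ((∑ i : A, μ i • v i : S) : (Fin n → ℝ) × ℝ).2 = _
        rw [e]
      · change ((∑ i : A, μ i • v i : S) : (Fin n → ℝ) × ℝ).1 = _
        rw [e]
  have hinj : ∀ k : ℕ, Set.InjOn (fun x : S => (x : (Fin n → ℝ) × ℝ).1)
      {x | x ∈ L ∧ x ∈ conicHull v ∧ ht x = k} := by
    rintro k x ⟨-, -, hx⟩ y ⟨-, -, hy⟩ h
    exact Subtype.ext (Prod.ext h (hx.trans hy.symm))
  have hcomp : IsCompact (convexHull ℝ (A : Set (Fin n → ℝ))) :=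
    A.finite_toSet.isCompact_convexHull ℝ
  obtain ⟨M, hM, hcount⟩ := exists_heights v hsp ht (fun _ => rfl) L
    (fun i => by
      obtain ⟨z, hz⟩ := hlat i i.2
      exact (hL _).2 ⟨z, 1, by simp [v, hz]⟩)
    (fun x hx => by
      obtain ⟨z, m, hz⟩ := (hL _).1 hx
      exact ⟨m, by change (x : (Fin n → ℝ) × ℝ).2 = _; rw [hz]⟩)
    (fun k => by
      refine Set.Finite.of_finite_image ?_ (hinj k)
      rw [himage]
      exact (finite_latt_mem (hcomp.smul _).isBounded).image _)
    (j := j) (by rw [finrank_homogSpan (by exact_mod_cast hA), hj]) (d := d)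
    (by
      rintro x hx ⟨μ, hμ, rfl⟩ k hk
      obtain ⟨z, m, hz⟩ := (hL _).1 hx
      obtain ⟨μ', hμ'⟩ := hext μ
      have hk' : ((∑ i, μ i • v i : S) : (Fin n → ℝ) × ℝ).2 = k := hk
      rw [hsum] at hz hk'
      refine hd k z μ' (fun a ha => ?_) ?_ ?_
      · rw [hμ' ⟨a, ha⟩]; exact hμ _
      · rw [← hk', ← Finset.sum_coe_sort]
        exact Finset.sum_congr rfl fun i _ => hμ' i
      · refine Eq.trans ?_ (congrArg Prod.fst hz)
        rw [← Finset.sum_coe_sort]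
        exact Finset.sum_congr rfl fun i _ => by rw [hμ' i])
  refine ⟨M, hM, fun k => ?_⟩
  rw [← hcount, latticeCount, ← Set.ncard_image_of_injective _ latt_injective, ← himage,
    (hinj k).ncard_image]

/-- The normalized volume of a lattice polytope of degree at most `d` in terms of the number of
lattice points of its dilates. -/
theorem exists_param_volume_eq {n j d : ℕ} {A : Finset (Fin n → ℝ)} (hA : A.Nonempty)
    (hlat : ∀ a ∈ A, ∃ z, a = latt z)
    (hj : Module.finrank ℝ (vectorSpan ℝ (A : Set (Fin n → ℝ))) = j)
    (hd : ∀ (k : ℕ) (z : Fin n → ℤ) (μ : (Fin n → ℝ) → ℝ), (∀ a ∈ A, 0 < μ a) →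
      ∑ a ∈ A, μ a = k → ∑ a ∈ A, μ a • a = latt z → j + 1 ≤ k + d) :
    ∃ φ : (Fin j → ℝ) →ᵃ[ℝ] (Fin n → ℝ),
      IsUnimodularParam (convexHull ℝ (A : Set (Fin n → ℝ))) φ ∧ ∀ D, d ≤ D →
        (j.factorial : ℝ) * (volume (φ ⁻¹' convexHull ℝ (A : Set (Fin n → ℝ)))).toReal =
          ∑ i ∈ Finset.range (D + 1), (-1 : ℝ) ^ (D - i) * (j.choose (D - i)) *
            latticeCount (convexHull ℝ (A : Set (Fin n → ℝ))) i := by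
  obtain ⟨φ, hφ⟩ := exists_isUnimodularParam (F := convexHull ℝ (A : Set (Fin n → ℝ)))
    (A := (A : Set (Fin n → ℝ))) (by exact_mod_cast hA) (fun a ha => hlat a ha)
    (affineSpan_convexHull _) (j := j) (by rw [affineSpan_convexHull, direction_affineSpan, hj])
  obtain ⟨M, hM, hcount⟩ := exists_multiset_latticeCount hA hlat hj hd
  exact ⟨φ, hφ, fun D hD => factorial_mul_limit_eq hM hcount
    (hφ.tendsto_card (convex_convexHull ℝ _) (A.finite_toSet.isCompact_convexHull ℝ)) hD⟩

section OptimalSets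

variable {E : Type*} [AddCommGroup E] [Module ℝ E]

open Classical in
/-- The points of `A` at which the functional `l` is maximal. -/
def optSet (A : Finset E) (l : Module.Dual ℝ E) : Finset E :=
  A.filter fun a => ∀ b ∈ A, l b ≤ l a

/-- `B` is the set of maximizers in `A` of a linear functional. -/
def IsFaceSet (A B : Finset E) : Prop := ∃ l, B = optSet A l

lemma mem_optSet {A : Finset E} {l : Module.Dual ℝ E} {a : E} :
    a ∈ optSet A l ↔ a ∈ A ∧ ∀ b ∈ A, l b ≤ l a := by
  simp [optSet]

lemma optSet_subset {A : Finset E} {l : Module.Dual ℝ E} : optSet A l ⊆ A :=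
  fun _ h => (mem_optSet.1 h).1

lemma IsFaceSet.subset {A B : Finset E} (h : IsFaceSet A B) : B ⊆ A := by
  obtain ⟨l, rfl⟩ := h
  exact optSet_subset

lemma IsFaceSet.nonempty {A B : Finset E} (h : IsFaceSet A B) (hA : A.Nonempty) :
    B.Nonempty := by
  obtain ⟨l, rfl⟩ := h
  obtain ⟨a, ha, hm⟩ := A.exists_max_image l hA
  exact ⟨a, mem_optSet.2 ⟨ha, hm⟩⟩

lemma finite_isFaceSet (A : Finset E) : {B | IsFaceSet A B}.Finite :=
  (A.powerset.finite_toSet).subset fun _ hB => Finset.mem_coe.2 (Finset.mem_powerset.2 hB.subset)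

lemma le_of_mem_convexHull {A : Set E} {l : Module.Dual ℝ E} {c : ℝ} (h : ∀ b ∈ A, l b ≤ c)
    {x : E} (hx : x ∈ convexHull ℝ A) : l x ≤ c :=
  convexHull_min (t := {y | l y ≤ c}) h (convex_halfSpace_le l.isLinear c) hx

lemma ge_of_mem_convexHull {A : Set E} {l : Module.Dual ℝ E} {c : ℝ} (h : ∀ b ∈ A, c ≤ l b)
    {x : E} (hx : x ∈ convexHull ℝ A) : c ≤ l x :=
  convexHull_min (t := {y | c ≤ l y}) h (convex_halfSpace_ge l.isLinear c) hx

lemma mem_convexHull_optSet {A : Finset E} {l : Module.Dual ℝ E} {x : E}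
    (hx : x ∈ convexHull ℝ (A : Set E)) :
    x ∈ convexHull ℝ (optSet A l : Set E) ↔ ∀ b ∈ A, l b ≤ l x := by
  constructor
  · intro h b hb
    exact ge_of_mem_convexHull (fun a ha => (mem_optSet.1 ha).2 b hb) h
  · intro h
    obtain ⟨w, h1, h2, h3⟩ := Finset.mem_convexHull'.1 hx
    have h4 : ∑ a ∈ A, w a * (l x - l a) = 0 := by
      have : l x = ∑ a ∈ A, w a * l a := by
        rw [← h3, map_sum]
        simp
      simp only [mul_sub, Finset.sum_sub_distrib]
      rw [← Finset.sum_mul, h2, ← this]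
      ring
    have h5 := (Finset.sum_eq_zero_iff_of_nonneg fun a ha =>
      mul_nonneg (h1 a ha) (sub_nonneg.2 (h a ha))).1 h4
    have h6 : ∀ a ∈ A, a ∉ optSet A l → w a = 0 := by
      intro a ha hn
      rcases mul_eq_zero.1 (h5 a ha) with h | h'
      · exact h
      · exact absurd (mem_optSet.2 ⟨ha, fun b hb => (h b hb).trans (by linarith)⟩) hn
    refine Finset.mem_convexHull'.2 ⟨w, fun a ha => h1 a (optSet_subset ha), ?_, ?_⟩
    · rw [Finset.sum_subset optSet_subset h6, h2]
    · rw [Finset.sum_subset optSet_subset fun a ha hn => by rw [h6 a ha hn, zero_smul], h3]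

lemma IsFaceSet.mem_of_mem_convexHull {A B : Finset E} (h : IsFaceSet A B) {a : E} (ha : a ∈ A)
    (haB : a ∈ convexHull ℝ (B : Set E)) : a ∈ B := by
  obtain ⟨l, rfl⟩ := h
  exact mem_optSet.2 ⟨ha, (mem_convexHull_optSet (subset_convexHull ℝ _ ha)).1 haB⟩

lemma IsFaceSet.subset_of_convexHull_subset {A B C : Finset E} (hB : IsFaceSet A B)
    (hC : C ⊆ A) (h : convexHull ℝ (C : Set E) ⊆ convexHull ℝ (B : Set E)) : C ⊆ B :=
  fun _ hc => hB.mem_of_mem_convexHull (hC hc) (h (subset_convexHull ℝ _ hc))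

lemma convexHull_injOn_isFaceSet (A : Finset E) :
    Set.InjOn (fun B : Finset E => convexHull ℝ (B : Set E)) {B | IsFaceSet A B} := by
  intro B hB C hC h
  exact Finset.Subset.antisymm (IsFaceSet.subset_of_convexHull_subset hC hB.subset h.le)
    (IsFaceSet.subset_of_convexHull_subset hB hC.subset h.ge)

/-- If `l₂` is at most `l₂ x` on the maximizers of `l₁`, then a functional of the form
`M • l₁ + l₂` is maximal at `x`. -/
lemma exists_smul_add_le {A : Finset E} {l₁ l₂ : Module.Dual ℝ E} {x : E}
    (h₁ : ∀ b ∈ A, l₁ b ≤ l₁ x) (h₂ : ∀ b ∈ A, l₁ b = l₁ x → l₂ b ≤ l₂ x) :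
    ∃ M : ℝ, 0 < M ∧ ∀ b ∈ A, (M • l₁ + l₂) b ≤ (M • l₁ + l₂) x ∧
      ((M • l₁ + l₂) b = (M • l₁ + l₂) x → l₁ b = l₁ x ∧ l₂ b = l₂ x) := by
  obtain ⟨t, ht, h⟩ := exists_small_pos
    (fun (b : A) (t : ℝ) => l₁ b < l₁ x → 0 < (l₁ x - l₁ b) + t * (l₂ x - l₂ b)) (by
      intro b
      by_cases hb : l₁ b < l₁ x
      · filter_upwards [eventually_add_mul_pos (a := l₂ x - l₂ b) (Or.inl (sub_pos.2 hb))] with t ht _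
        exact ht
      · exact Filter.Eventually.of_forall fun t h => absurd h hb)
  refine ⟨t⁻¹, inv_pos.2 ht, fun b hb => ?_⟩
  simp only [LinearMap.add_apply, LinearMap.smul_apply, smul_eq_mul]
  rcases (h₁ b hb).lt_or_eq with hlt | he
  · have h3 := mul_pos (inv_pos.2 ht) (h ⟨b, hb⟩ hlt)
    have h4 : t⁻¹ * ((l₁ x - l₁ b) + t * (l₂ x - l₂ b)) =
        t⁻¹ * l₁ x + l₂ x - (t⁻¹ * l₁ b + l₂ b) := by
      field_simp
      ring
    rw [h4] at h3
    exact ⟨by linarith, fun h => by linarith⟩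
  · have := h₂ b hb he
    rw [he]
    exact ⟨by linarith, fun h => ⟨rfl, by linarith⟩⟩

end OptimalSets

lemma finrank_direction_convexHull {n : ℕ} (B : Set (Fin n → ℝ)) :
    Module.finrank ℝ (affineSpan ℝ (convexHull ℝ B)).direction =
      Module.finrank ℝ (vectorSpan ℝ B) := by
  rw [affineSpan_convexHull, direction_affineSpan]

lemma isFaceOfDim_convexHull_iff {n : ℕ} {A : Finset (Fin n → ℝ)} (hA : A.Nonempty)
    {F : Set (Fin n → ℝ)} {j : ℕ} :
    IsFaceOfDim (convexHull ℝ (A : Set (Fin n → ℝ))) F j ↔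
      ∃ B, IsFaceSet A B ∧ F = convexHull ℝ (B : Set (Fin n → ℝ)) ∧
        Module.finrank ℝ (vectorSpan ℝ (B : Set (Fin n → ℝ))) = j := by
  have key : ∀ l : Module.Dual ℝ (Fin n → ℝ), convexHull ℝ (optSet A l : Set (Fin n → ℝ)) =
      {x | x ∈ convexHull ℝ (A : Set (Fin n → ℝ)) ∧
        ∀ y ∈ convexHull ℝ (A : Set (Fin n → ℝ)), l y ≤ l x} := by
    intro l
    ext x
    constructor
    · intro h
      have hx := convexHull_mono (Finset.coe_subset.2 optSet_subset) h
      exact ⟨hx, fun y hy => le_of_mem_convexHull ((mem_convexHull_optSet hx).1 h) hy⟩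
    · rintro ⟨hx, h⟩
      exact (mem_convexHull_optSet hx).2 fun b hb => h b (subset_convexHull ℝ _ hb)
  constructor
  · rintro ⟨hne, hexp, hdim⟩
    obtain ⟨l, hl⟩ := hexp hne
    have : F = convexHull ℝ (optSet A l.toLinearMap : Set (Fin n → ℝ)) := by
      rw [key, hl]; rfl
    refine ⟨_, ⟨l.toLinearMap, rfl⟩, this, ?_⟩
    rw [← finrank_direction_convexHull, ← this, hdim]
  · rintro ⟨B, hB, rfl, hdim⟩
    refine ⟨?_, ?_, by rw [finrank_direction_convexHull, hdim]⟩
    · exact (hB.nonempty hA).to_set.convexHull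
    · obtain ⟨l, rfl⟩ := hB
      intro _
      exact ⟨l.toContinuousLinearMap, key l⟩

section Interior

variable {E : Type*} [NormedAddCommGroup E] [NormedSpace ℝ E]

/-- The linear map `μ ↦ (∑ a, μ a • a, ∑ a, μ a)`. -/
def homogMap (A : Finset E) : (A → ℝ) →ₗ[ℝ] E × ℝ :=
  Fintype.linearCombination ℝ fun a : A => ((a : E), (1 : ℝ))

lemma homogMap_apply (A : Finset E) (μ : A → ℝ) :
    homogMap A μ = (∑ a, μ a • (a : E), ∑ a, μ a) := by
  ext <;> simp [homogMap, Fintype.linearCombination_apply, Prod.fst_sum, Prod.snd_sum]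

lemma range_homogMap (A : Finset E) : LinearMap.range (homogMap A) = homogSpan (A : Set E) := by
  rw [homogMap, Fintype.range_linearCombination, homogSpan]
  congr 1
  ext x
  simp

lemma sum_mem_interior_smul_convexHull [FiniteDimensional ℝ E] {S : Finset E} (hS : S.Nonempty)
    (hsp : homogSpan (S : Set E) = ⊤) {μ : E → ℝ} (hμ : ∀ a ∈ S, 0 < μ a) :
    ∑ a ∈ S, μ a • a ∈ interior ((∑ a ∈ S, μ a) • convexHull ℝ (S : Set E)) := by
  have hsurj : Function.Surjective (homogMap S) :=
    LinearMap.range_eq_top.1 ((range_homogMap S).trans hsp)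
  have hop : IsOpen (homogMap S '' Set.pi Set.univ fun _ => Set.Ioi 0) :=
    (homogMap S).isOpenMap_of_finiteDimensional hsurj _
      (isOpen_set_pi Set.finite_univ fun _ _ => isOpen_Ioi)
  have hop2 : IsOpen ((fun y : E => (y, ∑ a ∈ S, μ a)) ⁻¹'
      (homogMap S '' Set.pi Set.univ fun _ => Set.Ioi 0)) :=
    hop.preimage (by fun_prop)
  refine mem_interior.2 ⟨_, ?_, hop2, ?_⟩
  · rintro y ⟨ν, hν, h⟩
    rw [homogMap_apply] at h
    classical
    rw [mem_smul_convexHull hS (Finset.sum_nonneg fun a ha => (hμ a ha).le)]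
    refine ⟨fun x => if h : x ∈ S then ν ⟨x, h⟩ else 0, fun a ha => ?_, ?_, ?_⟩
    · simp only [ha, dif_pos]
      exact (hν ⟨a, ha⟩ trivial).le
    · refine Eq.trans ?_ (congrArg Prod.snd h)
      rw [← Finset.sum_coe_sort]
      exact Finset.sum_congr rfl fun i _ => by simp
    · refine Eq.trans ?_ (congrArg Prod.fst h)
      rw [← Finset.sum_coe_sort]
      exact Finset.sum_congr rfl fun i _ => by simp
  · refine ⟨fun a => μ a, fun a _ => hμ a a.2, ?_⟩
    rw [homogMap_apply, ← Finset.sum_coe_sort S, ← Finset.sum_coe_sort S]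

lemma exists_homogSpan_eq_top [FiniteDimensional ℝ E] [DecidableEq E] {A : Finset E}
    (hA : homogSpan (A : Set E) = ⊤) (c : ℕ) :
    ∀ B : Finset E, B ⊆ A →
      Module.finrank ℝ (E × ℝ) ≤ Module.finrank ℝ (homogSpan (B : Set E)) + c →
      ∃ T : Finset E, Disjoint B T ∧ T ⊆ A ∧ T.card ≤ c ∧
        homogSpan ((B ∪ T : Finset E) : Set E) = ⊤ := by
  induction c with
  | zero =>
    intro B hB h
    refine ⟨∅, by simp, by simp, by simp, ?_⟩
    rw [Finset.union_empty]
    exact Submodule.eq_top_of_finrank_eq (le_antisymm (Submodule.finrank_le _) h)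
  | succ c ih =>
    intro B hB h
    by_cases hall : ∀ a ∈ A, ((a, 1) : E × ℝ) ∈ homogSpan (B : Set E)
    · refine ⟨∅, by simp, by simp, by simp, ?_⟩
      rw [Finset.union_empty, eq_top_iff, ← hA]
      refine Submodule.span_le.2 ?_
      rintro _ ⟨a, ha, rfl⟩
      exact hall a ha
    · push Not at hall
      obtain ⟨a, ha, hna⟩ := hall
      have haB : a ∉ B := fun h => hna (Submodule.subset_span ⟨a, h, rfl⟩)
      have hlt : homogSpan (B : Set E) < homogSpan ((insert a B : Finset E) : Set E) := by
        refine lt_of_le_of_ne (Submodule.span_mono (Set.image_mono ?_)) fun he => hna ?_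
        · exact_mod_cast Finset.subset_insert a B
        · rw [he]
          exact Submodule.subset_span ⟨a, by simp, rfl⟩
      have hr := Submodule.finrank_lt_finrank_of_lt hlt
      obtain ⟨T, h1, h2, h3, h4⟩ := ih (insert a B) (Finset.insert_subset ha hB) (by omega)
      rw [Finset.disjoint_insert_left] at h1
      refine ⟨insert a T, ?_, Finset.insert_subset ha h2, ?_, ?_⟩
      · rw [Finset.disjoint_insert_right]
        exact ⟨haB, h1.2⟩
      · rw [Finset.card_insert_of_notMem h1.1]
        omega
      · rw [← h4]
        congr 2
        ext
        simp

lemma homogSpan_eq_top [FiniteDimensional ℝ E] {A : Set E} (h : affineSpan ℝ A = ⊤) :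
    homogSpan A = ⊤ := by
  have hne : A.Nonempty := (AffineSubspace.nonempty_of_affineSpan_eq_top ℝ E E h)
  refine Submodule.eq_top_of_finrank_eq ?_
  rw [finrank_homogSpan hne, ← direction_affineSpan, h, AffineSubspace.direction_top, finrank_top,
    Module.finrank_prod, Module.finrank_self]

end Interior

/-- A positive lattice combination of points spanning a `j`-dimensional subspace bounds the
codegree. -/
theorem cd_add_le {n j k : ℕ} {A B : Finset (Fin n → ℝ)} (hlat : ∀ a ∈ A, ∃ z, a = latt z)
    (hfull : affineSpan ℝ (A : Set (Fin n → ℝ)) = ⊤) (hBA : B ⊆ A) (hB : B.Nonempty)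
    (hj : Module.finrank ℝ (vectorSpan ℝ (B : Set (Fin n → ℝ))) = j) {z : Fin n → ℤ}
    {μ : (Fin n → ℝ) → ℝ} (hμ : ∀ a ∈ B, 0 < μ a) (hk : ∑ a ∈ B, μ a = k)
    (hz : ∑ a ∈ B, μ a • a = latt z) :
    cd (convexHull ℝ (A : Set (Fin n → ℝ))) + j ≤ k + n := by
  classical
  have hjn : j ≤ n := by
    have := Submodule.finrank_le (vectorSpan ℝ (B : Set (Fin n → ℝ)))
    simpa [hj] using this
  obtain ⟨T, h1, h2, h3, h4⟩ := exists_homogSpan_eq_top (homogSpan_eq_top hfull) (n - j) B hBA (by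
    rw [finrank_homogSpan (by exact_mod_cast hB), hj]
    simp
    omega)
  let ν : (Fin n → ℝ) → ℝ := fun a => if a ∈ B then μ a else 1
  have hνB : ∀ a ∈ B, ν a = μ a := fun a ha => if_pos ha
  have hνT : ∀ a ∈ T, ν a = 1 := fun a ha => if_neg (Finset.disjoint_right.1 h1 ha)
  have hsum : ∑ a ∈ B ∪ T, ν a = ((k + T.card : ℕ) : ℝ) := by
    rw [Finset.sum_union h1, Finset.sum_congr rfl hνB, Finset.sum_congr rfl hνT, hk]
    simp
  have hT : ∀ T' : Finset (Fin n → ℝ), T' ⊆ A → ∃ z : Fin n → ℤ, ∑ a ∈ T', a = latt z := by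
    intro T'
    induction T' using Finset.induction with
    | empty => exact fun _ => ⟨0, by ext; simp [latt]⟩
    | insert a s ha ih =>
      intro h
      obtain ⟨z₁, e₁⟩ := ih ((Finset.subset_insert _ _).trans h)
      obtain ⟨z₂, e₂⟩ := hlat a (h (Finset.mem_insert_self _ _))
      exact ⟨z₂ + z₁, by rw [Finset.sum_insert ha, e₁, latt_add, ← e₂]⟩
  obtain ⟨z', hz'⟩ := hT T h2
  have hint := sum_mem_interior_smul_convexHull (hB.mono Finset.subset_union_left) h4 (μ := ν) (by
    intro a ha
    rcases Finset.mem_union.1 ha with h | h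
    · rw [hνB a h]; exact hμ a h
    · rw [hνT a h]; exact one_pos)
  rw [hsum, Finset.sum_union h1, Finset.sum_congr rfl fun a ha => by rw [hνB a ha],
    Finset.sum_congr rfl fun a (ha : a ∈ T) => by rw [hνT a ha, one_smul], hz, hz',
    ← latt_add] at hint
  have hk1 : 1 ≤ k := by
    have : (0 : ℝ) < k := by rw [← hk]; exact Finset.sum_pos hμ hB
    exact_mod_cast this
  have hle : cd (convexHull ℝ (A : Set (Fin n → ℝ))) ≤ k + T.card := by
    refine Nat.sInf_le ⟨by omega, z + z', interior_subset_intrinsicInterior ?_⟩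
    refine interior_mono (Set.smul_set_mono (convexHull_mono ?_)) hint
    exact_mod_cast Finset.union_subset hBA h2
  omega

section RelativeInterior

variable {E : Type*} [NormedAddCommGroup E] [NormedSpace ℝ E]

/-- Either `x` is a positive convex combination of all points of `B`, or `B` and `x` can be
properly separated. -/
lemma exists_pos_combination_or_separation {B : Finset E} {x : E}
    (hx : x ∈ convexHull ℝ (B : Set E)) :
    (∃ μ : E → ℝ, (∀ a ∈ B, 0 < μ a) ∧ ∑ a ∈ B, μ a = 1 ∧ ∑ a ∈ B, μ a • a = x) ∨
      ∃ l : Module.Dual ℝ E, (∀ a ∈ B, l a ≤ l x) ∧ ∃ a ∈ B, l a < l x := by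
  classical
  rw [or_iff_not_imp_left]
  intro hno
  obtain ⟨w, h1, h2, h3⟩ := Finset.mem_convexHull'.1 hx
  have hw : homogMap B (fun a => w a) = (x, 1) := by
    rw [homogMap_apply, ← h2, ← h3, ← Finset.sum_coe_sort B, ← Finset.sum_coe_sort B]
  let f := (homogMap B).rangeRestrict
  have hopen : IsOpen (f '' Set.pi Set.univ fun _ => Set.Ioi 0) :=
    f.isOpenMap_of_finiteDimensional (homogMap B).surjective_rangeRestrict _
      (isOpen_set_pi Set.finite_univ fun _ _ => isOpen_Ioi)
  have hconv : Convex ℝ (f '' Set.pi Set.univ fun _ => Set.Ioi 0) :=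
    (convex_pi fun _ _ => convex_Ioi 0).linear_image f
  have hnot : f (fun a => w a) ∉ f '' Set.pi Set.univ fun _ => Set.Ioi 0 := by
    rintro ⟨ν, hν, h⟩
    have h' : homogMap B ν = (x, 1) := (congrArg Subtype.val h).trans hw
    rw [homogMap_apply] at h'
    refine hno ⟨fun x => if h : x ∈ B then ν ⟨x, h⟩ else 0, fun a ha => ?_, ?_, ?_⟩
    · simp only [ha, dif_pos]
      exact hν ⟨a, ha⟩ trivial
    · refine Eq.trans ?_ (congrArg Prod.snd h')
      rw [← Finset.sum_coe_sort]
      exact Finset.sum_congr rfl fun i _ => by simp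
    · refine Eq.trans ?_ (congrArg Prod.fst h')
      rw [← Finset.sum_coe_sort]
      exact Finset.sum_congr rfl fun i _ => by simp
  obtain ⟨g, hg⟩ := geometric_hahn_banach_open_point hconv hopen hnot
  obtain ⟨G, hG⟩ := LinearMap.exists_extend (g : LinearMap.range (homogMap B) →ₗ[ℝ] ℝ)
  have hgG : ∀ ν : B → ℝ, g (f ν) = ∑ a, ν a * G (a, 1) := by
    intro ν
    have : g (f ν) = G (homogMap B ν) := (LinearMap.congr_fun hG (f ν)).symm
    rw [this, homogMap, Fintype.linearCombination_apply, map_sum]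
    simp only [map_smul, smul_eq_mul]
  have hlt : ∀ ν : B → ℝ, (∀ a, 0 < ν a) → ∑ a, ν a * G (a, 1) < ∑ a : B, w a * G (a, 1) := by
    intro ν hν
    rw [← hgG, ← hgG fun a => w a]
    exact hg _ ⟨ν, fun a _ => hν a, rfl⟩
  set c := ∑ a : B, w a * G (a, 1)
  have hone := hlt (fun _ => 1) fun _ => one_pos
  set s := ∑ a : B, (1 : ℝ) * G (a, 1)
  have hc : 0 ≤ c := by
    by_contra hneg
    push Not at hneg
    rcases le_or_gt 0 s with h | h
    · linarith
    · have := hlt (fun _ => c / s) fun _ => div_pos_of_neg_of_neg hneg h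
      rw [← Finset.mul_sum] at this
      have e : ∑ a : B, G ((a : E), (1 : ℝ)) = s := by simp [s]
      rw [e, div_mul_cancel₀ _ h.ne] at this
      exact this.false
  have hle : ∀ a : B, G (a, 1) ≤ 0 := by
    intro a
    by_contra! hpos
    have h4 := hlt (fun b => 1 + if b = a then (c - s) / G (a, 1) else 0) (fun b => by
      have : 0 < (c - s) / G (a, 1) := div_pos (by linarith) hpos
      split_ifs
      · linarith
      · linarith)
    simp only [add_mul, Finset.sum_add_distrib, ite_mul, zero_mul, Finset.sum_ite_eq',
      Finset.mem_univ, if_true] at h4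
    rw [div_mul_cancel₀ _ hpos.ne'] at h4
    change s + (c - s) < c at h4
    linarith
  have hc0 : c = 0 := le_antisymm (Finset.sum_nonpos fun a _ =>
    mul_nonpos_of_nonneg_of_nonpos (h1 a a.2) (hle a)) hc
  let l : Module.Dual ℝ E := G ∘ₗ LinearMap.inl ℝ E ℝ
  have hl : ∀ y : E, l y = G (y, 1) - G (0, 1) := by
    intro y
    rw [← map_sub]
    simp [l]
  have hx0 : G (x, 1) = 0 := by
    rw [← hw, ← hc0, homogMap, Fintype.linearCombination_apply, map_sum]
    simp only [map_smul, smul_eq_mul, c]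
  refine ⟨l, fun a ha => ?_, ?_⟩
  · rw [hl, hl, hx0]
    have := hle ⟨a, ha⟩
    linarith
  · by_contra! hall
    have : ∀ a : B, G (a, 1) = 0 := fun a => le_antisymm (hle a) (by
      have := hall a a.2
      rw [hl, hl, hx0] at this
      linarith)
    have : s = 0 := Finset.sum_eq_zero fun a _ => by rw [this a, mul_zero]
    linarith

lemma exists_pos_combination {A : Finset E} {l₁ : Module.Dual ℝ E} {x : E}
    (hx : x ∈ convexHull ℝ (A : Set E)) (h₁ : ∀ b ∈ A, l₁ b ≤ l₁ x)
    (hmin : ∀ l : Module.Dual ℝ E, (∀ b ∈ A, l b ≤ l x) → optSet A l₁ ⊆ optSet A l) :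
    ∃ μ : E → ℝ, (∀ a ∈ optSet A l₁, 0 < μ a) ∧ ∑ a ∈ optSet A l₁, μ a = 1 ∧
      ∑ a ∈ optSet A l₁, μ a • a = x := by
  have hxB := (mem_convexHull_optSet hx).2 h₁
  refine (exists_pos_combination_or_separation hxB).resolve_right ?_
  rintro ⟨l, hl, a, ha, hlt⟩
  have hmem : ∀ b ∈ A, l₁ b = l₁ x → b ∈ optSet A l₁ := fun b hb h =>
    mem_optSet.2 ⟨hb, fun b' hb' => by rw [h]; exact h₁ b' hb'⟩
  obtain ⟨M, -, hM⟩ := exists_smul_add_le h₁ (l₂ := l) fun b hb h => hl b (hmem b hb h)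
  have h3 := hmin (M • l₁ + l) (fun b hb => (hM b hb).1) ha
  have hxA := le_of_mem_convexHull (l := M • l₁ + l) (mem_optSet.1 h3).2 hx
  have := ((hM a (optSet_subset ha)).2
    (le_antisymm (hM a (optSet_subset ha)).1 hxA)).2
  exact hlt.ne this

end RelativeInterior

section Polar

variable {E : Type*} [AddCommGroup E] [Module ℝ E]

lemma exists_first_hit {U : Finset E} {l l' : Module.Dual ℝ E} (hl : ∀ u ∈ U, l u ≤ 0)
    (h0 : ∀ u ∈ U, l u = 0 → l' u = 0) (hpos : ∃ u ∈ U, 0 < l' u) :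
    ∃ t : ℝ, 0 < t ∧ (∀ u ∈ U, (l + t • l') u ≤ 0) ∧
      ∃ u ∈ U, 0 < l' u ∧ (l + t • l') u = 0 := by
  classical
  obtain ⟨u₀, hu₀, hu₀'⟩ := hpos
  obtain ⟨u, hu, hmin⟩ := (U.filter fun u => 0 < l' u).exists_min_image (fun u => -l u / l' u)
    ⟨u₀, Finset.mem_filter.2 ⟨hu₀, hu₀'⟩⟩
  obtain ⟨huU, hul⟩ := Finset.mem_filter.1 hu
  have hlt : 0 < -l u := by
    have h1 := hl u huU
    have h2 : l u ≠ 0 := fun h => hul.ne' (h0 u huU h)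
    have := lt_of_le_of_ne h1 h2
    linarith
  have ht : 0 < -l u / l' u := div_pos hlt hul
  refine ⟨-l u / l' u, ht, fun b hb => ?_, u, huU, hul, ?_⟩
  · simp only [LinearMap.add_apply, LinearMap.smul_apply, smul_eq_mul]
    rcases le_or_gt (l' b) 0 with h | h
    · have := mul_nonpos_of_nonneg_of_nonpos ht.le h
      have := hl b hb
      linarith
    · have h3 := hmin b (Finset.mem_filter.2 ⟨hb, h⟩)
      have h4 := mul_le_mul_of_nonneg_right h3 h.le
      rw [div_mul_cancel₀ _ h.ne'] at h4
      linarith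
  · simp only [LinearMap.add_apply, LinearMap.smul_apply, smul_eq_mul]
    rw [div_mul_cancel₀ _ hul.ne']
    ring

/-- The rank of the set of points of `U` at which `l` vanishes. -/
def zeroRank (U : Finset E) (l : Module.Dual ℝ E) : ℕ :=
  Module.finrank ℝ (Submodule.span ℝ {u | u ∈ U ∧ l u = 0})

variable [FiniteDimensional ℝ E]

lemma eq_zero_of_zeroRank_eq {U : Finset E} {l : Module.Dual ℝ E}
    (h : zeroRank U l = Module.finrank ℝ E) : l = 0 := by
  have h1 := Submodule.eq_top_of_finrank_eq h
  have h2 : Submodule.span ℝ {u | u ∈ U ∧ l u = 0} ≤ LinearMap.ker l :=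
    Submodule.span_le.2 fun u hu => hu.2
  rw [h1, top_le_iff] at h2
  exact LinearMap.ker_eq_top.1 h2

/-- The polar cone of a finite spanning set is generated by its extreme rays. -/
lemma mem_closure_extreme {U : Finset E} (hU : Submodule.span ℝ (U : Set E) = ⊤) (c : ℕ) :
    ∀ l : Module.Dual ℝ E, (∀ u ∈ U, l u ≤ 0) → Module.finrank ℝ E ≤ zeroRank U l + c →
      l ∈ AddSubmonoid.closure {l : Module.Dual ℝ E |
        (∀ u ∈ U, l u ≤ 0) ∧ zeroRank U l + 1 = Module.finrank ℝ E} := by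
  induction c with
  | zero =>
    intro l hl h
    rw [eq_zero_of_zeroRank_eq (le_antisymm (Submodule.finrank_le _) h)]
    exact zero_mem _
  | succ c ih =>
    intro l hl h
    rcases lt_trichotomy (zeroRank U l + 1) (Module.finrank ℝ E) with hlt | heq | hgt
    swap
    · exact AddSubmonoid.subset_closure ⟨hl, heq⟩
    swap
    · rw [eq_zero_of_zeroRank_eq (le_antisymm (Submodule.finrank_le _) (Nat.lt_succ_iff.1 hgt))]
      exact zero_mem _
    set Z := {u | u ∈ U ∧ l u = 0} with hZ
    have hW : Submodule.span ℝ {∑ u ∈ U, u} ⊔ Submodule.span ℝ Z < ⊤ := by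
      refine lt_top_iff_ne_top.2 fun htop => ?_
      have h1 := Submodule.finrank_add_le_finrank_add_finrank
        (Submodule.span ℝ {∑ u ∈ U, u}) (Submodule.span ℝ Z)
      rw [htop, finrank_top] at h1
      have h2 := finrank_span_le_card (R := ℝ) ({∑ u ∈ U, u} : Set E)
      simp at h2
      change _ ≤ _ + zeroRank U l at h1
      omega
    obtain ⟨l', hl'0, hl'⟩ := Submodule.exists_le_ker_of_lt_top _ hW
    have hsum : ∑ u ∈ U, l' u = 0 := by
      rw [← map_sum]
      exact hl' (Submodule.mem_sup_left (Submodule.mem_span_singleton_self _))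
    have hZ' : Submodule.span ℝ Z ≤ LinearMap.ker l' := le_sup_right.trans hl'
    have hne : ∃ u ∈ U, l' u ≠ 0 := by
      by_contra! hall
      refine hl'0 (LinearMap.ker_eq_top.1 (top_le_iff.1 ?_))
      rw [← hU]
      exact Submodule.span_le.2 hall
    have h0 : ∀ u ∈ U, l u = 0 → l' u = 0 := fun u hu h =>
      hZ' (Submodule.subset_span ⟨hu, h⟩)
    have hstep : ∀ m : Module.Dual ℝ E, (∀ u ∈ U, l u = 0 → m u = 0) → (∃ u ∈ U, 0 < m u) →
        ∃ t : ℝ, 0 < t ∧ ∀ s : ℝ, 0 < s → s • (l + t • m) ∈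
          AddSubmonoid.closure {l : Module.Dual ℝ E |
            (∀ u ∈ U, l u ≤ 0) ∧ zeroRank U l + 1 = Module.finrank ℝ E} := by
      intro m hm0 hmpos
      obtain ⟨t, ht, hle, u, hu, hmu, hu0⟩ := exists_first_hit hl hm0 hmpos
      refine ⟨t, ht, fun s hs => ih _ (fun u hu => ?_) ?_⟩
      · rw [LinearMap.smul_apply, smul_eq_mul]
        exact mul_nonpos_of_nonneg_of_nonpos hs.le (hle u hu)
      · have hlt' : Submodule.span ℝ Z <
            Submodule.span ℝ {u | u ∈ U ∧ (s • (l + t • m)) u = 0} := by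
          refine lt_of_le_of_ne (Submodule.span_mono ?_) fun he => ?_
          · rintro b ⟨hb, hb0⟩
            refine ⟨hb, ?_⟩
            simp [hb0, hm0 b hb hb0]
          · have h1 : u ∈ Submodule.span ℝ Z := by
              rw [he]
              exact Submodule.subset_span ⟨hu, by rw [LinearMap.smul_apply, hu0, smul_zero]⟩
            have h2 : Submodule.span ℝ Z ≤ LinearMap.ker m :=
              Submodule.span_le.2 fun b hb => hm0 b hb.1 hb.2
            exact hmu.ne' (h2 h1)
        have := Submodule.finrank_lt_finrank_of_lt hlt'
        change zeroRank U l < zeroRank U (s • (l + t • m)) at this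
        omega
    obtain ⟨t₁, ht₁, h₁⟩ := hstep l' h0
      (Finset.exists_pos_of_sum_zero_of_exists_nonzero _ hsum hne)
    obtain ⟨t₂, ht₂, h₂⟩ := hstep (-l') (fun u hu h => by simp [h0 u hu h])
      (Finset.exists_pos_of_sum_zero_of_exists_nonzero _ (by simp [hsum]) (by simpa using hne))
    have e : l = (t₂ / (t₁ + t₂)) • (l + t₁ • l') + (t₁ / (t₁ + t₂)) • (l + t₂ • -l') := by
      ext x
      simp only [LinearMap.add_apply, LinearMap.smul_apply, smul_eq_mul, LinearMap.neg_apply]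
      field_simp
      ring
    rw [e]
    exact add_mem (h₁ _ (by positivity)) (h₂ _ (by positivity))

end Polar

section SimpleVertex

variable {E : Type*} [AddCommGroup E] [Module ℝ E]

lemma mem_optSet_iff_eq {A : Finset E} {l : Module.Dual ℝ E} {v a : E} (hv : v ∈ A)
    (hl : ∀ a ∈ A, l a ≤ l v) : a ∈ optSet A l ↔ a ∈ A ∧ l a = l v := by
  rw [mem_optSet]
  exact ⟨fun h => ⟨h.1, le_antisymm (hl a h.1) (h.2 v hv)⟩,
    fun h => ⟨h.1, fun b hb => (hl b hb).trans h.2.ge⟩⟩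

lemma vectorSpan_optSet [DecidableEq E] {A : Finset E} {l : Module.Dual ℝ E} {v : E} (hv : v ∈ A)
    (hl : ∀ a ∈ A, l a ≤ l v) :
    vectorSpan ℝ (optSet A l : Set E) =
      Submodule.span ℝ {u | u ∈ A.image (fun a => a - v) ∧ l u = 0} := by
  have hvo : v ∈ (optSet A l : Set E) := mem_optSet.2 ⟨hv, hl⟩
  rw [vectorSpan_eq_span_vsub_set_right ℝ hvo]
  congr 1
  ext u
  simp only [Set.mem_image, Finset.mem_coe, mem_optSet_iff_eq hv hl, Set.mem_ofPred_eq,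
    Finset.mem_image, vsub_eq_sub]
  constructor
  · rintro ⟨a, ⟨ha, h⟩, rfl⟩
    exact ⟨⟨a, ha, rfl⟩, by rw [map_sub, h, sub_self]⟩
  · rintro ⟨⟨a, ha, rfl⟩, h⟩
    rw [map_sub, sub_eq_zero] at h
    exact ⟨a, ⟨ha, h⟩, rfl⟩

variable [FiniteDimensional ℝ E]

/-- Two functionals in the polar cone of a spanning set with the same zero set of corank one are
proportional. -/
lemma exists_nonneg_smul_eq {U : Finset E} (hU : Submodule.span ℝ (U : Set E) = ⊤)
    {l m : Module.Dual ℝ E} (hl : ∀ u ∈ U, l u ≤ 0) (hm : ∀ u ∈ U, m u ≤ 0)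
    (hz : Submodule.span ℝ {u | u ∈ U ∧ l u = 0} = Submodule.span ℝ {u | u ∈ U ∧ m u = 0})
    (hr : zeroRank U m + 1 = Module.finrank ℝ E) : ∃ c : ℝ, 0 ≤ c ∧ l = c • m := by
  have hm0 : m ≠ 0 := by
    rintro rfl
    have : zeroRank U 0 = Module.finrank ℝ E := by
      have h0 : {u | u ∈ U ∧ (0 : Module.Dual ℝ E) u = 0} = (U : Set E) := by
        ext u
        simp
      rw [zeroRank, h0, hU, finrank_top]
    omega
  obtain ⟨u, hu, hmu⟩ : ∃ u ∈ U, m u ≠ 0 := by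
    by_contra! hall
    refine hm0 (LinearMap.ker_eq_top.1 (top_le_iff.1 ?_))
    rw [← hU]
    exact Submodule.span_le.2 hall
  set W := Submodule.span ℝ {u | u ∈ U ∧ m u = 0} with hW
  have hWm : W ≤ LinearMap.ker m := Submodule.span_le.2 fun b hb => hb.2
  have hWl : W ≤ LinearMap.ker l := by
    rw [← hz]
    exact Submodule.span_le.2 fun b hb => hb.2
  have hlt : W < W ⊔ Submodule.span ℝ {u} := by
    refine lt_of_le_of_ne le_sup_left fun he => hmu (hWm ?_)
    rw [he]
    exact Submodule.mem_sup_right (Submodule.mem_span_singleton_self u)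
  have htop : W ⊔ Submodule.span ℝ {u} = ⊤ := by
    refine Submodule.eq_top_of_finrank_eq (le_antisymm (Submodule.finrank_le _) ?_)
    have := Submodule.finrank_lt_finrank_of_lt hlt
    change zeroRank U m < _ at this
    omega
  refine ⟨l u / m u, div_nonneg_of_nonpos (hl u hu) (hm u hu), ?_⟩
  rw [← sub_eq_zero, ← LinearMap.ker_eq_top, ← top_le_iff, ← htop]
  refine sup_le (fun w hw => ?_) ((Submodule.span_singleton_le_iff_mem _ _).2 ?_)
  · have h1 : l w = 0 := hWl hw
    have h2 : m w = 0 := hWm hw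
    simp [h1, h2]
  · simp [div_mul_cancel₀ _ hmu]

/-- The polar cone at a simple vertex is simplicial. -/
theorem exists_basis_of_simple_vertex {A : Finset E} (hfull : affineSpan ℝ (A : Set E) = ⊤)
    {v : E} {l₀ : Module.Dual ℝ E} (hv : optSet A l₀ = {v})
    (hsimple : {B | IsFaceSet A B ∧ v ∈ B ∧
      Module.finrank ℝ (vectorSpan ℝ (B : Set E)) + 1 = Module.finrank ℝ E}.ncard =
        Module.finrank ℝ E) :
    ∃ L : Fin (Module.finrank ℝ E) → Module.Dual ℝ E, LinearIndependent ℝ L ∧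
      (∀ i, ∀ a ∈ A, L i a ≤ L i v) ∧ ∀ l : Module.Dual ℝ E, (∀ a ∈ A, l a ≤ l v) →
        ∃ c : Fin (Module.finrank ℝ E) → ℝ, (∀ i, 0 ≤ c i) ∧ l = ∑ i, c i • L i := by
  classical
  set n := Module.finrank ℝ E with hn
  have hvo : v ∈ optSet A l₀ := by rw [hv]; exact Finset.mem_singleton_self v
  obtain ⟨hvA, hl₀⟩ := mem_optSet.1 hvo
  set U := A.image fun a => a - v with hUdef
  have hU : Submodule.span ℝ (U : Set E) = ⊤ := by
    rw [← AffineSubspace.direction_top ℝ E E, ← hfull, direction_affineSpan,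
      vectorSpan_eq_span_vsub_set_right ℝ (Finset.mem_coe.2 hvA), hUdef, Finset.coe_image]
    rfl
  have hpol : ∀ l : Module.Dual ℝ E, (∀ u ∈ U, l u ≤ 0) ↔ ∀ a ∈ A, l a ≤ l v := by
    intro l
    simp only [hUdef, Finset.mem_image, forall_exists_index, and_imp, forall_apply_eq_imp_iff₂,
      map_sub, sub_nonpos]
  let 𝓕 := {B | IsFaceSet A B ∧ v ∈ B ∧
      Module.finrank ℝ (vectorSpan ℝ (B : Set E)) + 1 = n}
  have hfin : 𝓕.Finite := (finite_isFaceSet A).subset fun B hB => hB.1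
  have : Finite 𝓕 := hfin
  let e : Fin n ≃ 𝓕 := (Finite.equivFinOfCardEq (by rw [Nat.card_coe_set_eq]; exact hsimple)).symm
  choose L hLo using fun i => (e i).2.1
  have hLpol : ∀ i, ∀ a ∈ A, L i a ≤ L i v := fun i => by
    have h := (e i).2.2.1
    rw [hLo i] at h
    exact (mem_optSet.1 h).2
  have hrank : ∀ l : Module.Dual ℝ E, (∀ a ∈ A, l a ≤ l v) →
      Module.finrank ℝ (vectorSpan ℝ (optSet A l : Set E)) = zeroRank U l := fun l hl => by
    rw [vectorSpan_optSet hvA hl]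
    rfl
  have hcone : ∀ l : Module.Dual ℝ E, (∀ a ∈ A, l a ≤ l v) →
      ∃ c : Fin n → ℝ, (∀ i, 0 ≤ c i) ∧ l = ∑ i, c i • L i := by
    intro l hl
    have hmem := mem_closure_extreme hU n l ((hpol l).2 hl) (Nat.le_add_left _ _)
    clear hl
    induction hmem using AddSubmonoid.closure_induction with
    | mem l hl =>
      obtain ⟨h1, h2⟩ := hl
      have h1' := (hpol l).1 h1
      obtain ⟨i, hi⟩ := e.surjective ⟨optSet A l, ⟨l, rfl⟩, mem_optSet.2 ⟨hvA, h1'⟩, by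
        rw [hrank l h1', h2]⟩
      have hopt : optSet A (L i) = optSet A l := by
        rw [← hLo i, hi]
      obtain ⟨c, hc, rfl⟩ := exists_nonneg_smul_eq hU h1 ((hpol _).2 (hLpol i)) (by
          rw [← vectorSpan_optSet hvA h1', ← vectorSpan_optSet hvA (hLpol i), hopt]) (by
          rw [← hrank _ (hLpol i), hopt, hrank l h1', h2])
      refine ⟨Pi.single i c, fun k => ?_, ?_⟩
      · rw [Pi.single_apply]
        split_ifs
        · exact hc
        · exact le_rfl
      · rw [Finset.sum_eq_single i]
        · simp
        · intro k _ hk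
          simp [hk]
        · simp
    | zero => exact ⟨0, fun _ => le_rfl, by simp⟩
    | add l m _ _ hl hm =>
      obtain ⟨c, hc, rfl⟩ := hl
      obtain ⟨c', hc', rfl⟩ := hm
      exact ⟨c + c', fun i => add_nonneg (hc i) (hc' i), by
        simp [add_smul, Finset.sum_add_distrib]⟩
  refine ⟨L, ?_, hLpol, hcone⟩
  have hspan : ∀ l : Module.Dual ℝ E, (∀ a ∈ A, l a ≤ l v) →
      l ∈ Submodule.span ℝ (Set.range L) := by
    intro l hl
    obtain ⟨c, -, rfl⟩ := hcone l hl
    exact Submodule.sum_mem _ fun i _ => Submodule.smul_mem _ _ (Submodule.subset_span ⟨i, rfl⟩)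
  refine linearIndependent_of_top_le_span_of_card_eq_finrank (fun l _ => ?_) ?_
  · obtain ⟨M, -, hM⟩ := exists_smul_add_le hl₀ (l₂ := l) fun b hb h => by
      have : b ∈ optSet A l₀ := (mem_optSet_iff_eq hvA hl₀).2 ⟨hb, h⟩
      rw [hv, Finset.mem_singleton] at this
      rw [this]
    have h1 := hspan _ fun a ha => (hM a ha).1
    have h2 := Submodule.smul_mem _ M (hspan _ hl₀)
    have := Submodule.sub_mem _ h1 h2
    rwa [add_sub_cancel_left] at this
  · rw [Fintype.card_fin, Subspace.dual_finrank_eq]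

end SimpleVertex

section PolarBasis

variable {E : Type*} [AddCommGroup E] [Module ℝ E] {ι : Type*} [Fintype ι]

/-- The functionals `L i` form a basis of a simplicial cone, the cone of all functionals whose
maximum on `A` is attained at `v`. -/
structure IsPolarBasis (A : Finset E) (v : E) (L : ι → Module.Dual ℝ E) : Prop where
  mem : v ∈ A
  linearIndependent : LinearIndependent ℝ L
  le : ∀ i, ∀ a ∈ A, L i a ≤ L i v
  exists_coeff : ∀ l : Module.Dual ℝ E, (∀ a ∈ A, l a ≤ l v) →
    ∃ c : ι → ℝ, (∀ i, 0 ≤ c i) ∧ l = ∑ i, c i • L i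

open Classical in
/-- The points of `A` at which all the functionals `L i`, `i ∈ S`, are maximal. -/
def tightSet (A : Finset E) (v : E) (L : ι → Module.Dual ℝ E) (S : Finset ι) : Finset E :=
  A.filter fun a => ∀ i ∈ S, L i a = L i v

lemma mem_tightSet {A : Finset E} {v : E} {L : ι → Module.Dual ℝ E} {S : Finset ι} {a : E} :
    a ∈ tightSet A v L S ↔ a ∈ A ∧ ∀ i ∈ S, L i a = L i v := by
  simp [tightSet]

lemma sum_smul_le_iff {L : ι → Module.Dual ℝ E} {c : ι → ℝ} (hc : ∀ i, 0 ≤ c i) {a x : E}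
    (h : ∀ i, L i a ≤ L i x) :
    (∑ i, c i • L i) x ≤ (∑ i, c i • L i) a ↔ ∀ i, c i ≠ 0 → L i a = L i x := by
  have hle : ∀ i ∈ Finset.univ, c i * L i a ≤ c i * L i x :=
    fun i _ => mul_le_mul_of_nonneg_left (h i) (hc i)
  simp only [LinearMap.sum_apply, LinearMap.smul_apply, smul_eq_mul]
  rw [show (∑ i, c i * L i x ≤ ∑ i, c i * L i a) ↔ ∑ i, c i * L i a = ∑ i, c i * L i x from
    ⟨fun h' => le_antisymm (Finset.sum_le_sum hle) h', fun h' => h'.ge⟩,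
    Finset.sum_eq_sum_iff_of_le hle]
  refine forall_congr' fun i => ?_
  simp only [Finset.mem_univ, true_imp_iff, mul_eq_mul_left_iff]
  tauto

namespace IsPolarBasis

variable {A : Finset E} {v : E} {L : ι → Module.Dual ℝ E}

lemma le_sum_smul (h : IsPolarBasis A v L) {c : ι → ℝ} (hc : ∀ i, 0 ≤ c i) :
    ∀ a ∈ A, (∑ i, c i • L i) a ≤ (∑ i, c i • L i) v := by
  intro a ha
  simp only [LinearMap.sum_apply, LinearMap.smul_apply, smul_eq_mul]
  exact Finset.sum_le_sum fun i _ => mul_le_mul_of_nonneg_left (h.le i a ha) (hc i)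

lemma optSet_sum_smul (h : IsPolarBasis A v L) {c : ι → ℝ} (hc : ∀ i, 0 ≤ c i) {S : Finset ι}
    (hS : ∀ i, i ∈ S ↔ c i ≠ 0) : optSet A (∑ i, c i • L i) = tightSet A v L S := by
  ext a
  rw [mem_optSet_iff_eq h.mem (h.le_sum_smul hc), mem_tightSet]
  refine and_congr_right fun ha => ?_
  simp only [hS]
  rw [← sum_smul_le_iff hc fun i => h.le i a ha]
  exact ⟨fun h' => h'.ge, fun h' => le_antisymm (h.le_sum_smul hc a ha) h'⟩

lemma exists_optSet_eq (h : IsPolarBasis A v L) (S : Finset ι) :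
    ∃ c : ι → ℝ, (∀ i, 0 ≤ c i) ∧ (∀ i, i ∈ S ↔ c i ≠ 0) ∧
      optSet A (∑ i, c i • L i) = tightSet A v L S := by
  classical
  refine ⟨fun i => if i ∈ S then 1 else 0, fun i => ?_, fun i => ?_, h.optSet_sum_smul
    (fun i => ?_) fun i => ?_⟩
  all_goals
    by_cases hi : i ∈ S <;> simp [hi]

lemma isFaceSet_tightSet (h : IsPolarBasis A v L) (S : Finset ι) :
    IsFaceSet A (tightSet A v L S) := by
  obtain ⟨c, -, -, hc⟩ := h.exists_optSet_eq S
  exact ⟨_, hc.symm⟩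

lemma exists_eq_tightSet (h : IsPolarBasis A v L) {B : Finset E} (hB : IsFaceSet A B)
    (hv : v ∈ B) : ∃ S, B = tightSet A v L S := by
  classical
  obtain ⟨l, rfl⟩ := hB
  obtain ⟨c, hc, rfl⟩ := h.exists_coeff l (mem_optSet.1 hv).2
  exact ⟨Finset.univ.filter fun i => c i ≠ 0, h.optSet_sum_smul hc (by simp)⟩

lemma mem_convexHull_tightSet (h : IsPolarBasis A v L) {x : E}
    (hx : x ∈ convexHull ℝ (A : Set E)) {S : Finset ι} :
    x ∈ convexHull ℝ (tightSet A v L S : Set E) ↔ ∀ i ∈ S, L i x = L i v := by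
  obtain ⟨c, hc, hS, he⟩ := h.exists_optSet_eq S
  simp only [hS]
  rw [← he, mem_convexHull_optSet hx,
    ← sum_smul_le_iff hc fun i => le_of_mem_convexHull (h.le i) hx]
  exact ⟨fun h' => h' v h.mem, fun h' b hb => (h.le_sum_smul hc b hb).trans h'⟩

variable [FiniteDimensional ℝ E]

lemma finrank_tightSet_add_card (h : IsPolarBasis A v L) (S : Finset ι) :
    Module.finrank ℝ (vectorSpan ℝ (tightSet A v L S : Set E)) + S.card =
      Module.finrank ℝ E := by
  classical
  set W := vectorSpan ℝ (tightSet A v L S : Set E) with hW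
  have hvS : v ∈ tightSet A v L S := mem_tightSet.2 ⟨h.mem, fun _ _ => rfl⟩
  have hann : W.dualAnnihilator = Submodule.span ℝ (Set.range fun i : S => L i) := by
    apply le_antisymm
    · intro l hl
      rw [Submodule.mem_dualAnnihilator] at hl
      obtain ⟨c, hc, hS, he⟩ := h.exists_optSet_eq S
      have hcle := h.le_sum_smul hc
      set lS := ∑ i, c i • L i with hlS
      have heval : ∀ y, lS y = ∑ i, c i * L i y := fun y => by
        simp [hlS]
      have hconst : ∀ b ∈ A, lS b = lS v → l b = l v := by
        intro b hb hbe
        have hbS : b ∈ tightSet A v L S := by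
          rw [← he]
          exact (mem_optSet_iff_eq h.mem hcle).2 ⟨hb, hbe⟩
        have := hl (b -ᵥ v) (vsub_mem_vectorSpan ℝ (Finset.mem_coe.2 hbS) (Finset.mem_coe.2 hvS))
        rwa [vsub_eq_sub, map_sub, sub_eq_zero] at this
      obtain ⟨M, -, hM⟩ := exists_smul_add_le hcle (l₂ := l) fun b hb hbe => (hconst b hb hbe).le
      obtain ⟨M', -, hM'⟩ := exists_smul_add_le hcle (l₂ := -l) fun b hb hbe => by
        simp [hconst b hb hbe]
      obtain ⟨e, hpos, hee⟩ := h.exists_coeff _ fun a ha => (hM a ha).1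
      obtain ⟨e', hpos', hee'⟩ := h.exists_coeff _ fun a ha => (hM' a ha).1
      have hsum : ∑ i, (e i + e' i - (M + M') * c i) • L i = 0 := by
        ext y
        have h1 := heval y
        have h2 := DFunLike.congr_fun hee y
        have h3 := DFunLike.congr_fun hee' y
        simp only [LinearMap.sum_apply, LinearMap.smul_apply, LinearMap.add_apply,
          LinearMap.neg_apply, LinearMap.zero_apply, smul_eq_mul, sub_mul, add_mul, mul_assoc,
          Finset.sum_sub_distrib, Finset.sum_add_distrib, ← Finset.mul_sum] at h1 h2 h3 ⊢
        rw [← h1, ← h2, ← h3]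
        ring
      have hzero := Fintype.linearIndependent_iff.1 h.linearIndependent _ hsum
      have hl' : l = ∑ i, (e i - M * c i) • L i := by
        ext y
        have h1 := heval y
        have h2 := DFunLike.congr_fun hee y
        simp only [LinearMap.sum_apply, LinearMap.smul_apply, LinearMap.add_apply, smul_eq_mul,
          sub_mul, mul_assoc, Finset.sum_sub_distrib, ← Finset.mul_sum] at h1 h2 ⊢
        rw [← h1, ← h2]
        ring
      rw [hl']
      refine Submodule.sum_mem _ fun i _ => ?_
      by_cases hi : i ∈ S
      · exact Submodule.smul_mem _ _ (Submodule.subset_span ⟨⟨i, hi⟩, rfl⟩)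
      · have hci : c i = 0 := by
          by_contra hne
          exact hi ((hS i).2 hne)
        have h1 := hzero i
        rw [hci] at h1
        have h2 : e i = 0 := by linarith [hpos i, hpos' i]
        simp [hci, h2]
    · refine Submodule.span_le.2 ?_
      rintro _ ⟨i, rfl⟩
      rw [SetLike.mem_coe, Submodule.mem_dualAnnihilator]
      change W ≤ LinearMap.ker (L i)
      rw [hW, vectorSpan_eq_span_vsub_set_right ℝ (Finset.mem_coe.2 hvS)]
      refine Submodule.span_le.2 ?_
      rintro _ ⟨a, ha, rfl⟩
      have := (mem_tightSet.1 (Finset.mem_coe.1 ha)).2 i i.2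
      simp [this]
  have hcard := finrank_span_eq_card
    (h.linearIndependent.comp (fun i : S => (i : ι)) Subtype.val_injective)
  rw [Fintype.card_coe] at hcard
  rw [← Subspace.finrank_add_finrank_dualAnnihilator_eq W, hann, ← hcard]
  rfl

lemma tightSet_injective (h : IsPolarBasis A v L) : Function.Injective (tightSet A v L) := by
  classical
  have key : ∀ S S' : Finset ι, tightSet A v L S = tightSet A v L S' → S ⊆ S' := by
    intro S S' he
    have hu : tightSet A v L (S ∪ S') = tightSet A v L S' := by
      ext a
      have := congrArg (a ∈ ·) he
      simp only [mem_tightSet, eq_iff_iff, Finset.mem_union, or_imp, forall_and] at this ⊢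
      tauto
    have h1 := h.finrank_tightSet_add_card (S ∪ S')
    have h2 := h.finrank_tightSet_add_card S'
    rw [hu] at h1
    rw [Finset.eq_of_subset_of_card_le (Finset.subset_union_right (s₁ := S) (s₂ := S')) (by omega)]
    exact Finset.subset_union_left
  exact fun S S' he => (key S S' he).antisymm (key S' S he.symm)

end IsPolarBasis

end PolarBasis

section LocalFaces

lemma exists_minimal_isFaceSet {E : Type*} [AddCommGroup E] [Module ℝ E] {A : Finset E} {x : E}
    (hx : x ∈ convexHull ℝ (A : Set E)) :
    ∃ l : Module.Dual ℝ E, ∀ B, IsFaceSet A B → x ∈ convexHull ℝ (B : Set E) →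
      optSet A l ⊆ B := by
  classical
  have hfin : {B | IsFaceSet A B ∧ x ∈ convexHull ℝ (B : Set E)}.Finite :=
    (finite_isFaceSet A).subset fun B hB => hB.1
  have : ∀ B : Finset E, ∃ l : Module.Dual ℝ E, IsFaceSet A B → B = optSet A l := fun B => by
    by_cases hB : IsFaceSet A B
    · obtain ⟨l, hl⟩ := hB
      exact ⟨l, fun _ => hl⟩
    · exact ⟨0, fun h => absurd h hB⟩
  choose g hg using this
  have hle : ∀ B ∈ hfin.toFinset, ∀ b ∈ A, g B b ≤ g B x := by
    intro B hB b hb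
    obtain ⟨h1, h2⟩ := hfin.mem_toFinset.1 hB
    rw [hg B h1] at h2
    exact (mem_convexHull_optSet hx).1 h2 b hb
  refine ⟨∑ B ∈ hfin.toFinset, g B, fun B hB hxB b hb => ?_⟩
  obtain ⟨hbA, hbm⟩ := mem_optSet.1 hb
  have h1 := le_of_mem_convexHull hbm hx
  simp only [LinearMap.sum_apply] at h1
  have h2 := (Finset.sum_eq_sum_iff_of_le fun B hB => hle B hB b hbA).1
    (le_antisymm (Finset.sum_le_sum fun B hB => hle B hB b hbA) h1)
  have hBm : B ∈ hfin.toFinset := hfin.mem_toFinset.2 ⟨hB, hxB⟩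
  rw [hg B hB]
  exact mem_optSet.2 ⟨hbA, fun b' hb' => by
    rw [h2 B hBm]
    exact hle B hBm b' hb'⟩

lemma exists_injOn_dual {n : ℕ} (A : Finset (Fin n → ℝ)) :
    ∃ w : Module.Dual ℝ (Fin n → ℝ), Set.InjOn w A := by
  obtain ⟨w, -, hw⟩ := exists_pos_generic
    (fun p : {p : A × A // p.1 ≠ p.2} => (p.1.1.1 - p.1.2.1 : Fin n → ℝ)) fun p h =>
      p.2 (Subtype.ext (sub_eq_zero.1 h))
  refine ⟨∑ i, w i • LinearMap.proj i, fun a ha b hb hab => ?_⟩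
  by_contra hne
  refine hw ⟨(⟨a, ha⟩, ⟨b, hb⟩), fun h => hne (congrArg Subtype.val h)⟩ ?_
  simp only [LinearMap.sum_apply, LinearMap.smul_apply, LinearMap.proj_apply, smul_eq_mul] at hab
  simp only [Pi.sub_apply, mul_sub, Finset.sum_sub_distrib, hab, sub_self]

lemma exists_vertex_mem_faces {n : ℕ} {A : Finset (Fin n → ℝ)} {x : Fin n → ℝ}
    (hx : x ∈ convexHull ℝ (A : Set (Fin n → ℝ))) :
    ∃ v l₀, optSet A l₀ = {v} ∧
      ∀ B, IsFaceSet A B → x ∈ convexHull ℝ (B : Set (Fin n → ℝ)) → v ∈ B := by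
  have hA : A.Nonempty := by
    rw [← Finset.coe_nonempty]
    exact convexHull_nonempty_iff.1 ⟨x, hx⟩
  obtain ⟨l, hl⟩ := exists_minimal_isFaceSet hx
  obtain ⟨w, hw⟩ := exists_injOn_dual A
  obtain ⟨v, hv, hmax⟩ := (optSet A l).exists_max_image w (IsFaceSet.nonempty ⟨l, rfl⟩ hA)
  obtain ⟨hvA, hvl⟩ := mem_optSet.1 hv
  obtain ⟨M, -, hM⟩ := exists_smul_add_le hvl (l₂ := w) fun b hb hbe =>
    hmax b ((mem_optSet_iff_eq hvA hvl).2 ⟨hb, hbe⟩)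
  refine ⟨v, M • l + w, ?_, fun B hB hxB => hl B hB hxB hv⟩
  ext a
  rw [mem_optSet_iff_eq hvA fun a ha => (hM a ha).1, Finset.mem_singleton]
  constructor
  · rintro ⟨ha, he⟩
    exact hw ha hvA ((hM a ha).2 he).2
  · rintro rfl
    exact ⟨hvA, rfl⟩

open Classical in
/-- The subsets of `A` spanning a face of `convexHull ℝ A` that contains `x`. -/
def facesAt {E : Type*} [AddCommGroup E] [Module ℝ E] (A : Finset E) (x : E) : Finset (Finset E) :=
  (finite_isFaceSet A).toFinset.filter fun B => x ∈ convexHull ℝ (B : Set E)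

lemma mem_facesAt {E : Type*} [AddCommGroup E] [Module ℝ E] {A B : Finset E} {x : E} :
    B ∈ facesAt A x ↔ IsFaceSet A B ∧ x ∈ convexHull ℝ (B : Set E) := by
  simp [facesAt]

/-- In a simple polytope the faces containing a given point are indexed by the subsets of a finite
set. -/
theorem exists_sum_facesAt_eq {n : ℕ} {A : Finset (Fin n → ℝ)}
    (hfull : affineSpan ℝ (A : Set (Fin n → ℝ)) = ⊤)
    (hsimple : ∀ v l₀, optSet A l₀ = {v} → {B | IsFaceSet A B ∧ v ∈ B ∧
      Module.finrank ℝ (vectorSpan ℝ (B : Set (Fin n → ℝ))) + 1 = n}.ncard = n)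
    {x : Fin n → ℝ} (hx : x ∈ convexHull ℝ (A : Set (Fin n → ℝ))) :
    ∃ (m : ℕ) (T : Finset (Fin m)) (B : Finset (Fin n → ℝ)) (μ : (Fin n → ℝ) → ℝ), B ∈ facesAt A x ∧
      Module.finrank ℝ (vectorSpan ℝ (B : Set (Fin n → ℝ))) + T.card = n ∧
      (∀ a ∈ B, 0 < μ a) ∧ ∑ a ∈ B, μ a = 1 ∧ ∑ a ∈ B, μ a • a = x ∧
      ∀ f : ℕ → ℝ, ∑ B ∈ facesAt A x, f (Module.finrank ℝ (vectorSpan ℝ (B : Set (Fin n → ℝ)))) =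
        ∑ S ∈ T.powerset, f (n - S.card) := by
  classical
  obtain ⟨v, l₀, hv, hvB⟩ := exists_vertex_mem_faces hx
  have hvA : v ∈ A := optSet_subset (hv ▸ Finset.mem_singleton_self v)
  obtain ⟨L, hL₁, hL₂, hL₃⟩ := exists_basis_of_simple_vertex hfull hv (by
    rw [Module.finrank_fin_fun]
    exact hsimple v l₀ hv)
  have hL : IsPolarBasis A v L := ⟨hvA, hL₁, hL₂, hL₃⟩
  have hdim := hL.finrank_tightSet_add_card
  simp only [Module.finrank_fin_fun] at hdim
  set T := Finset.univ.filter fun i => L i x = L i v with hT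
  have hmem : ∀ B, B ∈ facesAt A x ↔ ∃ S ∈ T.powerset, tightSet A v L S = B := by
    intro B
    rw [mem_facesAt]
    constructor
    · rintro ⟨hB, hxB⟩
      obtain ⟨S, rfl⟩ := hL.exists_eq_tightSet hB (hvB B hB hxB)
      refine ⟨S, Finset.mem_powerset.2 fun i hi => ?_, rfl⟩
      exact Finset.mem_filter.2 ⟨Finset.mem_univ _, (hL.mem_convexHull_tightSet hx).1 hxB i hi⟩
    · rintro ⟨S, hS, rfl⟩
      refine ⟨hL.isFaceSet_tightSet S, (hL.mem_convexHull_tightSet hx).2 fun i hi => ?_⟩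
      exact (Finset.mem_filter.1 (Finset.mem_powerset.1 hS hi)).2
  have hTm : tightSet A v L T ∈ facesAt A x := (hmem _).2 ⟨T, Finset.mem_powerset_self T, rfl⟩
  obtain ⟨hTf, hTx⟩ := mem_facesAt.1 hTm
  obtain ⟨l, hl⟩ := hTf
  obtain ⟨μ, hμ⟩ := exists_pos_combination hx (l₁ := l) (by
      rw [hl] at hTx
      exact (mem_convexHull_optSet hx).1 hTx) fun l' hl' => by
    obtain ⟨S, hS, hSe⟩ := (hmem (optSet A l')).1
      (mem_facesAt.2 ⟨⟨l', rfl⟩, (mem_convexHull_optSet hx).2 hl'⟩)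
    rw [← hl, ← hSe]
    intro a ha
    rw [mem_tightSet] at ha ⊢
    exact ⟨ha.1, fun i hi => ha.2 i (Finset.mem_powerset.1 hS hi)⟩
  rw [← hl] at hμ
  refine ⟨_, T, tightSet A v L T, μ, hTm, hdim T, hμ.1, hμ.2.1, hμ.2.2, fun f => ?_⟩
  have himg : facesAt A x = T.powerset.image (tightSet A v L) := by
    ext B
    rw [hmem, Finset.mem_image]
  rw [himg, Finset.sum_image hL.tightSet_injective.injOn]
  refine Finset.sum_congr rfl fun S _ => ?_
  congr 1
  have := hdim S
  omega

end LocalFaces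

section Cancellation

variable {n d : ℕ} {A : Finset (Fin n → ℝ)}

lemma exists_large_sum_facesAt_eq (hlat : ∀ a ∈ A, ∃ z, a = latt z)
    (hfull : affineSpan ℝ (A : Set (Fin n → ℝ)) = ⊤)
    (hsimple : ∀ v l₀, optSet A l₀ = {v} → {B | IsFaceSet A B ∧ v ∈ B ∧
      Module.finrank ℝ (vectorSpan ℝ (B : Set (Fin n → ℝ))) + 1 = n}.ncard = n)
    (hdeg : d + cd (convexHull ℝ (A : Set (Fin n → ℝ))) = n + 1)
    {i : ℕ} (hi : 1 ≤ i) {z : Fin n → ℤ} {x : Fin n → ℝ} (hxz : (i : ℝ) • x = latt z)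
    (hx : x ∈ convexHull ℝ (A : Set (Fin n → ℝ))) :
    ∃ (m : ℕ) (T : Finset (Fin m)), T.card ≤ n ∧ n + 1 ≤ T.card + i + d ∧
      ∀ f : ℕ → ℝ, ∑ B ∈ facesAt A x, f (Module.finrank ℝ (vectorSpan ℝ (B : Set (Fin n → ℝ)))) =
        ∑ S ∈ T.powerset, f (n - S.card) := by
  obtain ⟨m, T, B, μ, hB, hdim, hpos, hsum, hcomb, hf⟩ := exists_sum_facesAt_eq hfull hsimple hx
  obtain ⟨hBf, hxB⟩ := mem_facesAt.1 hB
  have hBne : B.Nonempty := by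
    rw [← Finset.coe_nonempty]
    exact convexHull_nonempty_iff.1 ⟨x, hxB⟩
  have hi0 : (0 : ℝ) < i := by exact_mod_cast hi
  have := cd_add_le (k := i) (z := z) (μ := fun a => i * μ a) hlat hfull hBf.subset hBne rfl
    (fun a ha => mul_pos hi0 (hpos a ha)) (by rw [← Finset.mul_sum, hsum, mul_one])
    (by simp only [mul_smul]; rw [← Finset.smul_sum, hcomb, hxz])
  exact ⟨m, T, by omega, by omega, hf⟩

lemma neg_one_pow_sub {n k : ℕ} (h : k ≤ n) : (-1 : ℝ) ^ (n - k) = (-1) ^ n * (-1) ^ k := by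
  obtain ⟨m, rfl⟩ := Nat.exists_eq_add_of_le h
  rw [Nat.add_sub_cancel_left, pow_add, mul_right_comm, ← mul_pow]
  norm_num

lemma sum_facesAt_choose_eq_zero (hlat : ∀ a ∈ A, ∃ z, a = latt z)
    (hfull : affineSpan ℝ (A : Set (Fin n → ℝ)) = ⊤)
    (hsimple : ∀ v l₀, optSet A l₀ = {v} → {B | IsFaceSet A B ∧ v ∈ B ∧
      Module.finrank ℝ (vectorSpan ℝ (B : Set (Fin n → ℝ))) + 1 = n}.ncard = n)
    (hdeg : d + cd (convexHull ℝ (A : Set (Fin n → ℝ))) = n + 1)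
    {i r : ℕ} (hi : 1 ≤ i) (hr : r + i + d ≤ n) {z : Fin n → ℤ} {x : Fin n → ℝ}
    (hxz : (i : ℝ) • x = latt z) (hx : x ∈ convexHull ℝ (A : Set (Fin n → ℝ))) :
    ∑ B ∈ facesAt A x, (-1 : ℝ) ^ Module.finrank ℝ (vectorSpan ℝ (B : Set (Fin n → ℝ))) *
      ((Module.finrank ℝ (vectorSpan ℝ (B : Set (Fin n → ℝ)))).choose r : ℝ) = 0 := by
  obtain ⟨m, T, hTn, hT, hf⟩ := exists_large_sum_facesAt_eq hlat hfull hsimple hdeg hi hxz hx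
  rw [hf fun k => (-1 : ℝ) ^ k * (k.choose r : ℝ)]
  rw [← mul_zero ((-1 : ℝ) ^ n), ← sum_powerset_alternating_choose T (r := r) (by omega) hTn,
    Finset.mul_sum]
  refine Finset.sum_congr rfl fun S hS => ?_
  rw [neg_one_pow_sub ((Finset.card_le_card (Finset.mem_powerset.1 hS)).trans hTn), mul_assoc]

lemma sum_facesAt_succ_mul_choose_eq_zero (hlat : ∀ a ∈ A, ∃ z, a = latt z)
    (hfull : affineSpan ℝ (A : Set (Fin n → ℝ)) = ⊤)
    (hsimple : ∀ v l₀, optSet A l₀ = {v} → {B | IsFaceSet A B ∧ v ∈ B ∧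
      Module.finrank ℝ (vectorSpan ℝ (B : Set (Fin n → ℝ))) + 1 = n}.ncard = n)
    (hdeg : d + cd (convexHull ℝ (A : Set (Fin n → ℝ))) = n + 1)
    {i r : ℕ} (hi : 1 ≤ i) (hr : r + 1 + i + d ≤ n) {z : Fin n → ℤ} {x : Fin n → ℝ}
    (hxz : (i : ℝ) • x = latt z) (hx : x ∈ convexHull ℝ (A : Set (Fin n → ℝ))) :
    ∑ B ∈ facesAt A x, (-1 : ℝ) ^ Module.finrank ℝ (vectorSpan ℝ (B : Set (Fin n → ℝ))) *
      ((Module.finrank ℝ (vectorSpan ℝ (B : Set (Fin n → ℝ))) : ℝ) + 1) *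
      ((Module.finrank ℝ (vectorSpan ℝ (B : Set (Fin n → ℝ)))).choose r : ℝ) = 0 := by
  obtain ⟨m, T, hTn, hT, hf⟩ := exists_large_sum_facesAt_eq hlat hfull hsimple hdeg hi hxz hx
  rw [hf fun k => (-1 : ℝ) ^ k * ((k : ℝ) + 1) * (k.choose r : ℝ)]
  rw [← mul_zero ((-1 : ℝ) ^ n * (r + 1)),
    ← sum_powerset_alternating_choose T (N := n + 1) (r := r + 1) (by omega) (by omega),
    Finset.mul_sum]
  refine Finset.sum_congr rfl fun S hS => ?_
  have hS' := (Finset.card_le_card (Finset.mem_powerset.1 hS)).trans hTn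
  have h1 : ((n - S.card : ℕ) + 1 : ℝ) * ((n - S.card).choose r : ℝ) =
      ((n + 1 - S.card).choose (r + 1) : ℝ) * (r + 1) := by
    rw [Nat.sub_add_comm hS']
    exact_mod_cast Nat.add_one_mul_choose_eq (n - S.card) r
  rw [neg_one_pow_sub hS', mul_assoc, h1]
  ring

end Cancellation

section FaceSums

variable {n d : ℕ} {A : Finset (Fin n → ℝ)}

lemma latticeCount_zero {F : Set (Fin n → ℝ)} (hF : F.Nonempty) : latticeCount F 0 = 1 := by
  rw [latticeCount, Nat.cast_zero, Set.zero_smul_set hF, Set.ncard_eq_one]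
  refine ⟨0, ?_⟩
  ext z
  simp only [Set.mem_ofPred_eq, Set.mem_zero, Set.mem_singleton_iff]
  constructor
  · intro h
    ext i
    have := congrFun h i
    simpa [latt] using this
  · rintro rfl
    ext i
    simp [latt]

lemma sum_mul_latticeCount_eq_zero {g : Finset (Fin n → ℝ) → ℝ} {i : ℕ} (hi : 1 ≤ i)
    (h : ∀ (z : Fin n → ℤ) (x : Fin n → ℝ), (i : ℝ) • x = latt z →
      x ∈ convexHull ℝ (A : Set (Fin n → ℝ)) → ∑ B ∈ facesAt A x, g B = 0) :
    ∑ B ∈ (finite_isFaceSet A).toFinset,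
      g B * latticeCount (convexHull ℝ (B : Set (Fin n → ℝ))) i = 0 := by
  classical
  have hi0 : (i : ℝ) ≠ 0 := by positivity
  have hfin : {z : Fin n → ℤ | latt z ∈ (i : ℝ) • convexHull ℝ (A : Set (Fin n → ℝ))}.Finite :=
    finite_latt_mem ((isBounded_convexHull.2 A.finite_toSet.isBounded).smul₀ _)
  have hcount : ∀ B ∈ (finite_isFaceSet A).toFinset,
      (latticeCount (convexHull ℝ (B : Set (Fin n → ℝ))) i : ℝ) =
        ∑ z ∈ hfin.toFinset,
          if latt z ∈ (i : ℝ) • convexHull ℝ (B : Set (Fin n → ℝ)) then 1 else 0 := by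
    intro B hB
    have hBA : B ⊆ A := ((finite_isFaceSet A).mem_toFinset.1 hB).subset
    rw [Finset.sum_boole, latticeCount, ← Set.ncard_coe_finset]
    congr 2
    ext z
    simp only [Set.mem_ofPred_eq, Finset.coe_filter, Set.Finite.mem_toFinset]
    exact ⟨fun hz => ⟨Set.smul_set_mono (convexHull_mono (Finset.coe_subset.2 hBA)) hz, hz⟩,
      fun hz => hz.2⟩
  rw [Finset.sum_congr rfl fun B hB => by rw [hcount B hB, Finset.mul_sum], Finset.sum_comm]
  refine Finset.sum_eq_zero fun z hz => ?_
  have hzA : latt z ∈ (i : ℝ) • convexHull ℝ (A : Set (Fin n → ℝ)) := hfin.mem_toFinset.1 hz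
  obtain ⟨x, hx, hxz⟩ := hzA
  refine Eq.trans ?_ (h z x hxz hx)
  rw [facesAt, Finset.sum_filter]
  refine Finset.sum_congr rfl fun B _ => ?_
  have : latt z ∈ (i : ℝ) • convexHull ℝ (B : Set (Fin n → ℝ)) ↔
      x ∈ convexHull ℝ (B : Set (Fin n → ℝ)) := by
    rw [← hxz]
    exact Set.smul_mem_smul_set_iff₀ hi0 _ _
  by_cases hxB : x ∈ convexHull ℝ (B : Set (Fin n → ℝ))
  · rw [if_pos (this.2 hxB), if_pos hxB, mul_one]
  · rw [if_neg (this.not.2 hxB), if_neg hxB, mul_zero]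

lemma sum_faceSets_eq (hA : A.Nonempty) {g : Finset (Fin n → ℝ) → ℕ → ℝ}
    {e : Finset (Fin n → ℝ) → ℝ} {D : ℕ}
    (h : ∀ i : ℕ, 1 ≤ i → i ≤ D → ∀ (z : Fin n → ℤ) (x : Fin n → ℝ), (i : ℝ) • x = latt z →
      x ∈ convexHull ℝ (A : Set (Fin n → ℝ)) → ∑ B ∈ facesAt A x, g B (D - i) = 0)
    (he : ∀ B, IsFaceSet A B → e B = ∑ i ∈ Finset.range (D + 1), (-1 : ℝ) ^ (D - i) *
      (g B (D - i) * latticeCount (convexHull ℝ (B : Set (Fin n → ℝ))) i)) :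
    ∑ B ∈ (finite_isFaceSet A).toFinset, e B =
      (-1) ^ D * ∑ B ∈ (finite_isFaceSet A).toFinset, g B D := by
  rw [Finset.sum_congr rfl fun B hB => he B ((finite_isFaceSet A).mem_toFinset.1 hB),
    Finset.sum_comm, Finset.sum_eq_single 0]
  · rw [← Finset.mul_sum, Nat.sub_zero]
    congr 1
    refine Finset.sum_congr rfl fun B hB => ?_
    have hBne := IsFaceSet.nonempty ((finite_isFaceSet A).mem_toFinset.1 hB) hA
    rw [latticeCount_zero (convexHull_nonempty_iff.2 (Finset.coe_nonempty.2 hBne)), Nat.cast_one,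
      mul_one]
  · intro i hi hi0
    rw [← Finset.mul_sum, sum_mul_latticeCount_eq_zero (Nat.one_le_iff_ne_zero.2 hi0)
      (h i (Nat.one_le_iff_ne_zero.2 hi0) (Nat.lt_succ_iff.1 (Finset.mem_range.1 hi))), mul_zero]
  · simp

/-- The alternating sum of the normalized volumes of the faces of a simple polytope of small
degree, weighted by dimension, vanishes. -/
theorem sum_faceSets_succ_mul_eq_zero (hA : A.Nonempty) (hlat : ∀ a ∈ A, ∃ z, a = latt z)
    (hfull : affineSpan ℝ (A : Set (Fin n → ℝ)) = ⊤)
    (hsimple : ∀ v l₀, optSet A l₀ = {v} → {B | IsFaceSet A B ∧ v ∈ B ∧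
      Module.finrank ℝ (vectorSpan ℝ (B : Set (Fin n → ℝ))) + 1 = n}.ncard = n)
    (hdeg : d + cd (convexHull ℝ (A : Set (Fin n → ℝ))) = n + 1) (hdn : 2 * d < n)
    {e : Finset (Fin n → ℝ) → ℝ} (he : ∀ B, IsFaceSet A B → ∀ D, d ≤ D →
      e B = ∑ i ∈ Finset.range (D + 1), (-1 : ℝ) ^ (D - i) *
        ((Module.finrank ℝ (vectorSpan ℝ (B : Set (Fin n → ℝ)))).choose (D - i)) *
        latticeCount (convexHull ℝ (B : Set (Fin n → ℝ))) i) :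
    ∑ B ∈ (finite_isFaceSet A).toFinset,
      (-1 : ℝ) ^ Module.finrank ℝ (vectorSpan ℝ (B : Set (Fin n → ℝ))) *
        ((Module.finrank ℝ (vectorSpan ℝ (B : Set (Fin n → ℝ))) : ℝ) + 1) * e B = 0 := by
  set dim : Finset (Fin n → ℝ) → ℕ :=
    fun B => Module.finrank ℝ (vectorSpan ℝ (B : Set (Fin n → ℝ))) with hdim
  have hX : ∀ D, d ≤ D → D + d ≤ n →
      ∑ B ∈ (finite_isFaceSet A).toFinset, (-1 : ℝ) ^ dim B * e B =
        (-1) ^ D * ∑ B ∈ (finite_isFaceSet A).toFinset, (-1 : ℝ) ^ dim B * ((dim B).choose D : ℝ) :=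
    fun D hD hDn => sum_faceSets_eq hA (g := fun B r => (-1 : ℝ) ^ dim B * ((dim B).choose r : ℝ))
      (fun i hi hiD z x hxz hx => sum_facesAt_choose_eq_zero hlat hfull hsimple hdeg hi
        (by omega) hxz hx) fun B hB => by
        rw [he B hB D hD, Finset.mul_sum]
        exact Finset.sum_congr rfl fun i _ => by ring
  have hY : ∑ B ∈ (finite_isFaceSet A).toFinset, (-1 : ℝ) ^ dim B * ((dim B : ℝ) + 1) * e B =
      (-1) ^ d * ∑ B ∈ (finite_isFaceSet A).toFinset,
        (-1 : ℝ) ^ dim B * ((dim B : ℝ) + 1) * ((dim B).choose d : ℝ) :=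
    sum_faceSets_eq hA (g := fun B r => (-1 : ℝ) ^ dim B * ((dim B : ℝ) + 1) *
        ((dim B).choose r : ℝ))
      (fun i hi hiD z x hxz hx => sum_facesAt_succ_mul_choose_eq_zero hlat hfull hsimple hdeg hi
        (by omega) hxz hx) fun B hB => by
        rw [he B hB d le_rfl, Finset.mul_sum]
        exact Finset.sum_congr rfl fun i _ => by ring
  have h1 := hX d le_rfl (by omega)
  have h2 := hX (d + 1) (Nat.le_succ d) (by omega)
  rw [hY]
  have hchoose : ∀ m : ℕ, ((m : ℝ) + 1) * (m.choose d : ℝ) =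
      (d + 1) * ((m.choose d : ℝ) + (m.choose (d + 1) : ℝ)) := by
    intro m
    have := Nat.add_one_mul_choose_eq m d
    rw [Nat.choose_succ_succ, mul_comm _ (d + 1)] at this
    exact_mod_cast this
  simp only [mul_assoc, hchoose]
  simp only [mul_left_comm _ ((d : ℝ) + 1), mul_add, Finset.sum_add_distrib, ← Finset.mul_sum]
  rw [h1, pow_succ] at h2
  linear_combination ((d : ℝ) + 1) * h2

end FaceSums

/-- Let `P ⊂ ℝ^n` be an `n`-dimensional simple lattice polytope of degree
`d = n + 1 - cd(P)` with `d < n`.  If `d < n - d`, then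
`c(P) = ∑_{j=0}^n (-1)^{n-j} (j+1) ∑_{F ∈ F(P)_j} Vol_ℤ(F) = 0`,
where `Vol_ℤ(F)` is the normalized volume of the `j`-dimensional face `F`, i.e. `j!` times
the Lebesgue volume of `F` pulled back along any unimodular parametrization of `aff F`. -/
theorem simple_low_degree_c_eq_zero {n d : ℕ} (P : Set (Fin n → ℝ))
    (hP : IsLatticePolytope P) (hfull : affineSpan ℝ P = ⊤)
    (hsimple : IsSimplePolytope P)
    (VolZ : ℕ → Set (Fin n → ℝ) → ℝ)
    (hVolZ : ∀ (j : ℕ) (F : Set (Fin n → ℝ)), IsFaceOfDim P F j →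
      ∀ φ : (Fin j → ℝ) →ᵃ[ℝ] (Fin n → ℝ), IsUnimodularParam F φ →
        VolZ j F = (Nat.factorial j : ℝ) * (volume (φ ⁻¹' F)).toReal)
    (hdeg : d + cd P = n + 1) (hdn : d < n) (hlt : d < n - d) :
    ∑ j ∈ Finset.range (n + 1),
      (-1 : ℝ) ^ (n - j) * (j + 1) * ∑ᶠ F ∈ {F | IsFaceOfDim P F j}, VolZ j F = 0 := by
  classical
  obtain ⟨A, hlat, rfl⟩ : ∃ A : Finset (Fin n → ℝ), (∀ a ∈ A, ∃ z, a = latt z) ∧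
      P = convexHull ℝ (A : Set (Fin n → ℝ)) := by
    obtain ⟨V, rfl⟩ := hP
    refine ⟨V.image latt, fun a ha => ?_, by rw [Finset.coe_image]⟩
    obtain ⟨z, -, rfl⟩ := Finset.mem_image.1 ha
    exact ⟨z, rfl⟩
  have hA : A.Nonempty := by
    rw [← Finset.coe_nonempty, ← convexHull_nonempty_iff (𝕜 := ℝ), ← affineSpan_nonempty ℝ, hfull]
    exact ⟨0, trivial⟩
  rw [affineSpan_convexHull] at hfull
  set dim : Finset (Fin n → ℝ) → ℕ :=
    fun B => Module.finrank ℝ (vectorSpan ℝ (B : Set (Fin n → ℝ))) with hdim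
  have hsimple' : ∀ v l₀, optSet A l₀ = {v} →
      {B | IsFaceSet A B ∧ v ∈ B ∧ dim B + 1 = n}.ncard = n := by
    intro v l₀ hv
    have h := hsimple {v} ((isFaceOfDim_convexHull_iff hA).2
      ⟨{v}, ⟨l₀, hv.symm⟩, by simp, by simp⟩)
    have hvA : v ∈ A := optSet_subset (hv ▸ Finset.mem_singleton_self v)
    rw [← (convexHull_injOn_isFaceSet A).mono (fun B hB => hB.1) |>.ncard_image]
    convert h using 2
    ext F
    simp only [Set.mem_image, Set.mem_ofPred_eq, isFaceOfDim_convexHull_iff hA,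
      Set.singleton_subset_iff]
    constructor
    · rintro ⟨B, ⟨hB, hvB, hBn⟩, rfl⟩
      exact ⟨⟨B, hB, rfl, Nat.eq_sub_of_add_eq hBn⟩, subset_convexHull ℝ _ (Finset.mem_coe.2 hvB)⟩
    · rintro ⟨⟨B, hB, rfl, hBn⟩, hvB⟩
      exact ⟨B, ⟨hB, hB.mem_of_mem_convexHull hvA hvB,
        by
          change dim B = n - 1 at hBn
          omega⟩, rfl⟩
  have he : ∀ B, IsFaceSet A B → ∀ D, d ≤ D →
      VolZ (dim B) (convexHull ℝ (B : Set (Fin n → ℝ))) =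
        ∑ i ∈ Finset.range (D + 1), (-1 : ℝ) ^ (D - i) * ((dim B).choose (D - i)) *
          latticeCount (convexHull ℝ (B : Set (Fin n → ℝ))) i := by
    intro B hB D hD
    have hBne := hB.nonempty hA
    obtain ⟨φ, hφ, hvol⟩ := exists_param_volume_eq (d := d) hBne
      (fun a ha => hlat a (hB.subset ha)) rfl fun k z μ hμ hk hz => by
        have := cd_add_le hlat hfull hB.subset hBne rfl hμ hk hz
        omega
    rw [hVolZ _ _ ((isFaceOfDim_convexHull_iff hA).2 ⟨B, hB, rfl, rfl⟩) φ hφ]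
    exact hvol D hD
  have hmain := sum_faceSets_succ_mul_eq_zero hA hlat hfull hsimple' hdeg (by omega) he
  have hfaces : ∀ j, ∑ᶠ F ∈ {F | IsFaceOfDim (convexHull ℝ (A : Set (Fin n → ℝ))) F j},
      VolZ j F = ∑ B ∈ (finite_isFaceSet A).toFinset with dim B = j,
        VolZ (dim B) (convexHull ℝ (B : Set (Fin n → ℝ))) := by
    intro j
    have himg : {F | IsFaceOfDim (convexHull ℝ (A : Set (Fin n → ℝ))) F j} =
        (fun B : Finset (Fin n → ℝ) => convexHull ℝ (B : Set (Fin n → ℝ))) ''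
          ((finite_isFaceSet A).toFinset.filter fun B => dim B = j : Finset (Finset (Fin n → ℝ))) := by
      ext F
      simp only [Set.mem_ofPred_eq, isFaceOfDim_convexHull_iff hA, Set.mem_image,
        Finset.coe_filter, Set.Finite.mem_toFinset]
      constructor
      · rintro ⟨B, hB, rfl, hj⟩
        exact ⟨B, ⟨hB, hj⟩, rfl⟩
      · rintro ⟨B, ⟨hB, hj⟩, rfl⟩
        exact ⟨B, hB, rfl, hj⟩
    rw [himg, finsum_mem_image ((convexHull_injOn_isFaceSet A).mono fun B hB =>
      (finite_isFaceSet A).mem_toFinset.1 (Finset.mem_filter.1 (Finset.mem_coe.1 hB)).1),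
      finsum_mem_coe_finset]
    exact Finset.sum_congr rfl fun B hB => by rw [(Finset.mem_filter.1 hB).2]
  rw [← mul_zero ((-1 : ℝ) ^ n), ← hmain, ← Finset.sum_fiberwise_of_maps_to
    (t := Finset.range (n + 1)) (g := dim), Finset.mul_sum]
  · refine Finset.sum_congr rfl fun j hj => ?_
    rw [hfaces, neg_one_pow_sub (Nat.lt_succ_iff.1 (Finset.mem_range.1 hj)), Finset.mul_sum,
      Finset.mul_sum]
    refine Finset.sum_congr rfl fun B hB => ?_
    have hBj : dim B = j := (Finset.mem_filter.1 hB).2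
    change _ = (-1 : ℝ) ^ n * ((-1 : ℝ) ^ dim B * ((dim B : ℝ) + 1) * _)
    rw [hBj]
    ring
  · intro B _
    rw [Finset.mem_range, Nat.lt_succ_iff]
    have := Submodule.finrank_le (vectorSpan ℝ (B : Set (Fin n → ℝ)))
    rwa [Module.finrank_fin_fun] at this
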